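/- arXiv:1704.01735 — 2 statements merged into one kernel-verified Lean document; each statement's English description precedes it below -/
import Mathlib

section
/- For every z in the upper half-plane ℍ: Φ18(x1(z),…,x6(z)) = Δ(z)·E6(z). -/
open Complex Finset

noncomputable section

/-- `ζ = exp(2πi/13)`. -/
def zeta13 : ℂ := Complex.exp (2 * Real.pi * Complex.I / 13)

local notation "ζ" => zeta13

/-- The diagonal matrix `T = diag(ζ^7, ζ^11, ζ^8, ζ^6, ζ^2, ζ^5)`. -/
def Tmat : Matrix (Fin 6) (Fin 6) ℂ :=
  Matrix.diagonal ![ζ ^ 7, ζ ^ 11, ζ ^ 8, ζ ^ 6, ζ ^ 2, ζ ^ 5]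

/-- The matrix `S = -(1/√13)·M`. -/
def Smat : Matrix (Fin 6) (Fin 6) ℂ :=
  (-(1 / (Real.sqrt 13 : ℂ))) • Matrix.of
    ![![ζ^12 - ζ, ζ^10 - ζ^3, ζ^4 - ζ^9, ζ^5 - ζ^8, ζ^2 - ζ^11, ζ^6 - ζ^7],
      ![ζ^10 - ζ^3, ζ^4 - ζ^9, ζ^12 - ζ, ζ^2 - ζ^11, ζ^6 - ζ^7, ζ^5 - ζ^8],
      ![ζ^4 - ζ^9, ζ^12 - ζ, ζ^10 - ζ^3, ζ^6 - ζ^7, ζ^5 - ζ^8, ζ^2 - ζ^11],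
      ![ζ^5 - ζ^8, ζ^2 - ζ^11, ζ^6 - ζ^7, ζ - ζ^12, ζ^3 - ζ^10, ζ^9 - ζ^4],
      ![ζ^2 - ζ^11, ζ^6 - ζ^7, ζ^5 - ζ^8, ζ^3 - ζ^10, ζ^9 - ζ^4, ζ - ζ^12],
      ![ζ^6 - ζ^7, ζ^5 - ζ^8, ζ^2 - ζ^11, ζ^9 - ζ^4, ζ - ζ^12, ζ^3 - ζ^10]]

/-- The matrix `H`, mapping `(z1,…,z6)` to `(z6, z4, z5, −z3, −z1, −z2)`. -/
def Hmat : Matrix (Fin 6) (Fin 6) ℂ :=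
  Matrix.of
    ![![0,0,0,0,0,1], ![0,0,0,1,0,0], ![0,0,0,0,1,0],
      ![0,0,-1,0,0,0], ![-1,0,0,0,0,0], ![0,-1,0,0,0,0]]

/-- The senary quadratic forms `A_0, …, A_6` (here `v 0 = z1, …, v 5 = z6`). -/
def A : ℕ → (Fin 6 → ℂ) → ℂ
  | 0, v => v 0 * v 3 + v 1 * v 4 + v 2 * v 5
  | 1, v => v 0 ^ 2 - 2 * v 2 * v 3
  | 2, v => -v 4 ^ 2 - 2 * v 1 * v 3
  | 3, v => v 1 ^ 2 - 2 * v 0 * v 4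
  | 4, v => v 2 ^ 2 - 2 * v 1 * v 5
  | 5, v => -v 3 ^ 2 - 2 * v 0 * v 5
  | 6, v => -v 5 ^ 2 - 2 * v 2 * v 4
  | _, _ => 0

/-- `w_ν = (A0 + ζ^ν A1 + ζ^{4ν} A2 + ζ^{9ν} A3 + ζ^{3ν} A4 + ζ^{12ν} A5 + ζ^{10ν} A6)^2`. -/
def w (ν : ℕ) (v : Fin 6 → ℂ) : ℂ :=
  (A 0 v + ζ ^ ν * A 1 v + ζ ^ (4 * ν) * A 2 v + ζ ^ (9 * ν) * A 3 v +
    ζ ^ (3 * ν) * A 4 v + ζ ^ (12 * ν) * A 5 v + ζ ^ (10 * ν) * A 6 v) ^ 2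

/-- `w_∞ = 13·A0^2`. -/
def winf (v : Fin 6 → ℂ) : ℂ := 13 * A 0 v ^ 2

/-- The senary cubic forms `D_0, …, D_12` (here `v 0 = z1, …, v 5 = z6`). -/
def D : ℕ → (Fin 6 → ℂ) → ℂ
  | 0, v => v 0 * v 1 * v 2
  | 1, v => 2 * v 1 * v 2 ^ 2 + v 1 ^ 2 * v 5 - v 3 ^ 2 * v 4 + v 0 * v 4 * v 5
  | 2, v => -v 5 ^ 3 + v 1 ^ 2 * v 3 - 2 * v 1 * v 4 ^ 2 + v 0 * v 3 * v 4 + 3 * v 2 * v 4 * v 5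
  | 3, v => 2 * v 0 * v 1 ^ 2 + v 0 ^ 2 * v 4 - v 3 * v 5 ^ 2 + v 2 * v 3 * v 4
  | 4, v => -v 1 ^ 2 * v 2 + v 0 * v 5 ^ 2 - 2 * v 3 ^ 2 * v 5 - v 0 * v 2 * v 4
  | 5, v => -v 3 ^ 3 + v 2 ^ 2 * v 4 - 2 * v 2 * v 5 ^ 2 + v 1 * v 4 * v 5 + 3 * v 0 * v 3 * v 5
  | 6, v => -v 4 ^ 3 + v 0 ^ 2 * v 5 - 2 * v 0 * v 3 ^ 2 + v 2 * v 3 * v 5 + 3 * v 1 * v 3 * v 4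
  | 7, v => -v 1 ^ 3 + v 2 * v 3 ^ 2 - v 0 * v 2 * v 5 - 3 * v 0 * v 1 * v 4 + 2 * v 0 ^ 2 * v 3
  | 8, v => -v 0 ^ 3 + v 1 * v 5 ^ 2 - v 1 * v 2 * v 4 - 3 * v 0 * v 2 * v 3 + 2 * v 2 ^ 2 * v 5
  | 9, v => 2 * v 0 ^ 2 * v 2 + v 2 ^ 2 * v 3 - v 4 ^ 2 * v 5 + v 1 * v 3 * v 5
  | 10, v => -v 0 * v 2 ^ 2 + v 1 * v 3 ^ 2 - 2 * v 3 * v 4 ^ 2 - v 0 * v 1 * v 5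
  | 11, v => -v 2 ^ 3 + v 0 * v 4 ^ 2 - v 0 * v 1 * v 3 - 3 * v 1 * v 2 * v 5 + 2 * v 1 ^ 2 * v 4
  | 12, v => -v 0 ^ 2 * v 1 + v 2 * v 4 ^ 2 - 2 * v 4 * v 5 ^ 2 - v 1 * v 2 * v 3
  | _, _ => 0

/-- The senary cubic form `D_∞ = z4 z5 z6`. -/
def Dinf (v : Fin 6 → ℂ) : ℂ := v 3 * v 4 * v 5

/-- The senary sextic forms `G_0, …, G_12`. -/
def Gs : ℕ → (Fin 6 → ℂ) → ℂ
  | 0, v => D 0 v ^ 2 + Dinf v ^ 2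
  | 1, v => -D 7 v ^ 2 + 2 * D 0 v * D 1 v + 10 * Dinf v * D 1 v + 2 * D 2 v * D 12 v
      - 2 * D 3 v * D 11 v - 4 * D 4 v * D 10 v - 2 * D 9 v * D 5 v
  | 2, v => -2 * D 1 v ^ 2 - 4 * D 0 v * D 2 v + 6 * Dinf v * D 2 v - 2 * D 4 v * D 11 v
      + 2 * D 5 v * D 10 v - 2 * D 6 v * D 9 v - 2 * D 7 v * D 8 v
  | 3, v => -D 8 v ^ 2 + 2 * D 0 v * D 3 v + 10 * Dinf v * D 3 v + 2 * D 6 v * D 10 v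
      - 2 * D 9 v * D 7 v - 4 * D 12 v * D 4 v - 2 * D 1 v * D 2 v
  | 4, v => -D 2 v ^ 2 + 10 * D 0 v * D 4 v - 2 * Dinf v * D 4 v + 2 * D 5 v * D 12 v
      - 2 * D 9 v * D 8 v - 4 * D 1 v * D 3 v - 2 * D 10 v * D 7 v
  | 5, v => -2 * D 9 v ^ 2 - 4 * D 0 v * D 5 v + 6 * Dinf v * D 5 v - 2 * D 10 v * D 8 v
      + 2 * D 6 v * D 12 v - 2 * D 2 v * D 3 v - 2 * D 11 v * D 7 v
  | 6, v => -2 * D 3 v ^ 2 - 4 * D 0 v * D 6 v + 6 * Dinf v * D 6 v - 2 * D 12 v * D 7 v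
      + 2 * D 2 v * D 4 v - 2 * D 5 v * D 1 v - 2 * D 8 v * D 11 v
  | 7, v => -2 * D 10 v ^ 2 + 6 * D 0 v * D 7 v + 4 * Dinf v * D 7 v - 2 * D 1 v * D 6 v
      - 2 * D 2 v * D 5 v - 2 * D 8 v * D 12 v - 2 * D 9 v * D 11 v
  | 8, v => -2 * D 4 v ^ 2 + 6 * D 0 v * D 8 v + 4 * Dinf v * D 8 v - 2 * D 3 v * D 5 v
      - 2 * D 6 v * D 2 v - 2 * D 11 v * D 10 v - 2 * D 1 v * D 7 v
  | 9, v => -D 11 v ^ 2 + 2 * D 0 v * D 9 v + 10 * Dinf v * D 9 v + 2 * D 5 v * D 4 v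
      - 2 * D 1 v * D 8 v - 4 * D 10 v * D 12 v - 2 * D 3 v * D 6 v
  | 10, v => -D 5 v ^ 2 + 10 * D 0 v * D 10 v - 2 * Dinf v * D 10 v + 2 * D 6 v * D 4 v
      - 2 * D 3 v * D 7 v - 4 * D 9 v * D 1 v - 2 * D 12 v * D 11 v
  | 11, v => -2 * D 12 v ^ 2 + 6 * D 0 v * D 11 v + 4 * Dinf v * D 11 v - 2 * D 9 v * D 2 v
      - 2 * D 5 v * D 6 v - 2 * D 7 v * D 4 v - 2 * D 3 v * D 8 v
  | 12, v => -D 6 v ^ 2 + 10 * D 0 v * D 12 v - 2 * Dinf v * D 12 v + 2 * D 2 v * D 10 v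
      - 2 * D 1 v * D 11 v - 4 * D 3 v * D 9 v - 2 * D 4 v * D 8 v
  | _, _ => 0

/-- `δ_ν = −13·G0 + Σ_{j=1}^{12} ζ^{jν} G_j`. -/
def deltaF (ν : ℕ) (v : Fin 6 → ℂ) : ℂ :=
  -13 * Gs 0 v + ∑ j ∈ Finset.Icc 1 12, ζ ^ (j * ν) * Gs j v

/-- `δ_∞ = 13^2·G0`. -/
def deltaInf (v : Fin 6 → ℂ) : ℂ := 13 ^ 2 * Gs 0 v

/-- `Φ4 = Σ_ν w_ν + w_∞`. -/
def Phi4 (v : Fin 6 → ℂ) : ℂ := (∑ ν ∈ Finset.range 13, w ν v) + winf v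

/-- `Φ8 = Σ_ν w_ν^2 + w_∞^2`. -/
def Phi8 (v : Fin 6 → ℂ) : ℂ := (∑ ν ∈ Finset.range 13, w ν v ^ 2) + winf v ^ 2

/-- `Φ12′ = −(1/(13·30))(Σ_ν w_ν^3 + w_∞^3)`. -/
def Phi12' (v : Fin 6 → ℂ) : ℂ :=
  -(1 / (13 * 30)) * ((∑ ν ∈ Finset.range 13, w ν v ^ 3) + winf v ^ 3)

/-- `Φ16 = Σ_ν w_ν^4 + w_∞^4`. -/
def Phi16 (v : Fin 6 → ℂ) : ℂ := (∑ ν ∈ Finset.range 13, w ν v ^ 4) + winf v ^ 4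

/-- `Φ20 = (1/(13·25))(Σ_ν w_ν^5 + w_∞^5)`. -/
def Phi20 (v : Fin 6 → ℂ) : ℂ :=
  (1 / (13 * 25)) * ((∑ ν ∈ Finset.range 13, w ν v ^ 5) + winf v ^ 5)

/-- `Φ12 = −(1/(13·52))(Σ_ν δ_ν^2 + δ_∞^2)`. -/
def Phi12 (v : Fin 6 → ℂ) : ℂ :=
  -(1 / (13 * 52)) * ((∑ ν ∈ Finset.range 13, deltaF ν v ^ 2) + deltaInf v ^ 2)

/-- `Φ18 = (1/(13·6))(Σ_ν δ_ν^3 + δ_∞^3)`. -/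
def Phi18 (v : Fin 6 → ℂ) : ℂ :=
  (1 / (13 * 6)) * ((∑ ν ∈ Finset.range 13, deltaF ν v ^ 3) + deltaInf v ^ 3)

/-- `Φ30 = −(1/(13·1315))(Σ_ν δ_ν^5 + δ_∞^5)`. -/
def Phi30 (v : Fin 6 → ℂ) : ℂ :=
  -(1 / (13 * 1315)) * ((∑ ν ∈ Finset.range 13, deltaF ν v ^ 5) + deltaInf v ^ 5)

/-- `q^α = exp(2πiαz)`. -/
def qp (α : ℚ) (z : ℂ) : ℂ := Complex.exp (2 * Real.pi * Complex.I * (α : ℂ) * z)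

/-- `Σ_{n∈ℤ} (−1)^n q^{(13n^2+cn)/2}`. -/
def thetaSum (c : ℤ) (z : ℂ) : ℂ :=
  ∑' n : ℤ, (-1 : ℂ) ^ n * qp ((13 * (n : ℚ) ^ 2 + (c : ℚ) * (n : ℚ)) / 2) z

/-- The theta constants of order 13: `a_1, …, a_6`. -/
def thc : ℕ → ℂ → ℂ
  | 1, z => qp (121 / 104) z * thetaSum 11 z
  | 2, z => qp (49 / 104) z * thetaSum 7 z
  | 3, z => qp (25 / 104) z * thetaSum 5 z
  | 4, z => -(qp (9 / 104) z * thetaSum 3 z)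
  | 5, z => qp (81 / 104) z * thetaSum 9 z
  | 6, z => qp (1 / 104) z * thetaSum 1 z
  | _, _ => 0

/-- The vector `A(z) = (a1(z), …, a6(z))`. -/
def Avec (z : ℂ) : Fin 6 → ℂ := fun i => thc (i.val + 1) z

/-- The Dedekind eta function `η(z) = q^{1/24} Π_{n=1}^∞ (1−q^n)`. -/
def etaF (z : ℂ) : ℂ :=
  qp (1 / 24) z * ∏' n : ℕ, (1 - Complex.exp (2 * Real.pi * Complex.I * z) ^ (n + 1))

/-- The vector `(x1(z), …, x6(z))` with `x_i(z) = η(z)·a_i(z)`. -/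
def X (z : ℂ) : Fin 6 → ℂ := fun i => etaF z * thc (i.val + 1) z

/-- The discriminant `Δ(z) = η(z)^24`. -/
def Delta (z : ℂ) : ℂ := etaF z ^ 24

/-- The Eisenstein series `E4(z) = (1/2) Σ_{gcd(m,n)=1} (mz+n)^{−4}`. -/
def E4 (z : ℂ) : ℂ :=
  (1 / 2) * ∑' p : {p : ℤ × ℤ // Int.gcd p.1 p.2 = 1},
    ((p.1.1 : ℂ) * z + (p.1.2 : ℂ)) ^ (-4 : ℤ)

/-- The Eisenstein series `E6(z) = (1/2) Σ_{gcd(m,n)=1} (mz+n)^{−6}`. -/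
def E6 (z : ℂ) : ℂ :=
  (1 / 2) * ∑' p : {p : ℤ × ℤ // Int.gcd p.1 p.2 = 1},
    ((p.1.1 : ℂ) * z + (p.1.2 : ℂ)) ^ (-6 : ℤ)

section

open scoped ZMod Real UpperHalfPlane

/-- The odd part of the finite Fourier transform on `ZMod 13`, with the root of unity `w`, in the
coordinates at `12, 10, 4, 5, 2, 6`. -/
def sineMap (w : ℂ) (v : Fin 6 → ℂ) : Fin 6 → ℂ :=
  ![(w - w ^ 12) * v 0 + (w ^ 3 - w ^ 10) * v 1 + (w ^ 9 - w ^ 4) * v 2 + (w ^ 8 - w ^ 5) * v 3 +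
      (w ^ 11 - w ^ 2) * v 4 + (w ^ 7 - w ^ 6) * v 5,
    (w ^ 3 - w ^ 10) * v 0 + (w ^ 9 - w ^ 4) * v 1 + (w - w ^ 12) * v 2 + (w ^ 11 - w ^ 2) * v 3 +
      (w ^ 7 - w ^ 6) * v 4 + (w ^ 8 - w ^ 5) * v 5,
    (w ^ 9 - w ^ 4) * v 0 + (w - w ^ 12) * v 1 + (w ^ 3 - w ^ 10) * v 2 + (w ^ 7 - w ^ 6) * v 3 +
      (w ^ 8 - w ^ 5) * v 4 + (w ^ 11 - w ^ 2) * v 5,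
    (w ^ 8 - w ^ 5) * v 0 + (w ^ 11 - w ^ 2) * v 1 + (w ^ 7 - w ^ 6) * v 2 + (w ^ 12 - w) * v 3 +
      (w ^ 10 - w ^ 3) * v 4 + (w ^ 4 - w ^ 9) * v 5,
    (w ^ 11 - w ^ 2) * v 0 + (w ^ 7 - w ^ 6) * v 1 + (w ^ 8 - w ^ 5) * v 2 + (w ^ 10 - w ^ 3) * v
      3 + (w ^ 4 - w ^ 9) * v 4 + (w ^ 12 - w) * v 5,
    (w ^ 7 - w ^ 6) * v 0 + (w ^ 8 - w ^ 5) * v 1 + (w ^ 11 - w ^ 2) * v 2 + (w ^ 4 - w ^ 9) * v 3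
      + (w ^ 12 - w) * v 4 + (w ^ 10 - w ^ 3) * v 5]

lemma geom_sum_eq_zero_expanded {w : ℂ} (hw : w ^ 13 = 1) (hw1 : w ≠ 1) :
    1 + w + w ^ 2 + w ^ 3 + w ^ 4 + w ^ 5 + w ^ 6 + w ^ 7 + w ^ 8 + w ^ 9 + w ^ 10 + w ^ 11 +
      w ^ 12 = 0 := by
  have h : (w - 1) * (1 + w + w ^ 2 + w ^ 3 + w ^ 4 + w ^ 5 + w ^ 6 + w ^ 7 + w ^ 8 + w ^ 9 +
      w ^ 10 + w ^ 11 + w ^ 12) = 0 := by linear_combination hw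
  exact (mul_eq_zero.mp h).resolve_left (sub_ne_zero.mpr hw1)

lemma D_zero_sineMap {w a b : ℂ}
    (hw : 1 + w + w ^ 2 + w ^ 3 + w ^ 4 + w ^ 5 + w ^ 6 + w ^ 7 + w ^ 8 + w ^ 9 + w ^ 10 + w ^ 11 +
      w ^ 12 = 0)
    (ha : a = w + w ^ 3 + w ^ 9 - w ^ 4 - w ^ 12 - w ^ 10)
    (hb : b = w ^ 2 + w ^ 6 + w ^ 5 - w ^ 8 - w ^ 11 - w ^ 7) (v : Fin 6 → ℂ) :
    D 0 (sineMap w v) =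
      (-2 * a + 3 * b) * D 0 v + (3 * a + 2 * b) * Dinf v - (a + b) * (D 1 v + D 3 v + D 9 v) -
        a * (D 2 v + D 5 v + D 6 v) + (a - b) * (D 4 v + D 10 v + D 12 v) -
        b * (D 7 v + D 8 v + D 11 v) := by
  simp only [D, Dinf, sineMap, Matrix.cons_val]
  generalize v 0 = x0, v 1 = x1, v 2 = x2, v 3 = x3, v 4 = x4, v 5 = x5
  obtain ⟨p, hp⟩ : ∃ p, p = w - w ^ 12 := ⟨_, rfl⟩
  obtain ⟨q, hq⟩ : ∃ q, q = w ^ 3 - w ^ 10 := ⟨_, rfl⟩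
  obtain ⟨r, hr⟩ : ∃ r, r = w ^ 9 - w ^ 4 := ⟨_, rfl⟩
  obtain ⟨P, hP⟩ : ∃ P, P = w ^ 8 - w ^ 5 := ⟨_, rfl⟩
  obtain ⟨Q, hQ⟩ : ∃ Q, Q = w ^ 11 - w ^ 2 := ⟨_, rfl⟩
  obtain ⟨R, hR⟩ : ∃ R, R = w ^ 7 - w ^ 6 := ⟨_, rfl⟩
  have h0 : p * q * r = b := by
    subst ha hb hp hq hr hP hQ hR
    linear_combination (w ^ 19 - w ^ 18 - w ^ 14 + w ^ 13 - w ^ 12 + w ^ 11 - w ^ 8 + 2 * w ^ 7 -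
      w ^ 5 + w ^ 3 - w ^ 2) * hw
  have h1 : p ^ 2 * q + p * r ^ 2 + q ^ 2 * r = -a + b := by
    subst ha hb hp hq hr hP hQ hR
    linear_combination (- w ^ 22 + w ^ 21 - w ^ 18 + 2 * w ^ 17 - w ^ 16 + w ^ 15 - w ^ 14 + 2 * w
      ^ 13 - 3 * w ^ 12 + 3 * w ^ 11 - 4 * w ^ 10 + w ^ 9 + 2 * w ^ 7 - w ^ 6 + w ^ 5 - 2 * w ^ 4
      + 2 * w ^ 3 - 2 * w ^ 2 + w) * hw
  have h2 : p ^ 2 * r + p * q ^ 2 + q * r ^ 2 = -2 * a - 2 * b := by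
    subst ha hb hp hq hr hP hQ hR
    linear_combination (w ^ 21 - 2 * w ^ 20 + w ^ 19 - 2 * w ^ 16 + 2 * w ^ 15 + 2 * w ^ 13 - 2 *
      w ^ 12 + 2 * w ^ 11 - 4 * w ^ 10 + 4 * w ^ 9 - w ^ 8 - 2 * w ^ 7 - w ^ 6 + 4 * w ^ 5 - 4 * w
      ^ 4 + 2 * w) * hw
  have h3 : p * q * R + p * r * Q + q * r * P = -2 * b := by
    subst ha hb hp hq hr hP hQ hR
    linear_combination (- w ^ 20 + w ^ 19 + w ^ 17 - 2 * w ^ 16 + w ^ 15 + w ^ 12 - w ^ 10 + 2 * w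
      ^ 9 - w ^ 8 - 3 * w ^ 7 + 2 * w ^ 5 - 2 * w ^ 3 + 2 * w ^ 2) * hw
  have h4 : p * q * P + p * r * R + q * r * Q = -a - b := by
    subst ha hb hp hq hr hP hQ hR
    linear_combination (- w ^ 16 + w ^ 15 + w ^ 13 - w ^ 12 + w ^ 11 - 2 * w ^ 10 + 2 * w ^ 9 - 2
      * w ^ 7 + 2 * w ^ 5 - 2 * w ^ 4 + w) * hw
  have h5 : p * q * Q + p * r * P + q * r * R = -a := by
    subst ha hb hp hq hr hP hQ hR
    linear_combination (w ^ 21 - w ^ 20 - w ^ 17 + w ^ 16 - w ^ 14 + 2 * w ^ 13 - w ^ 12 - w ^ 10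
      + w ^ 9 + w ^ 7 - w ^ 6 + w ^ 5 - 2 * w ^ 4 + w ^ 3 - w ^ 2 + w) * hw
  have h6 : p ^ 3 + 3 * p * q * r + q ^ 3 + r ^ 3 = -2 * a + 3 * b := by
    subst ha hb hp hq hr hP hQ hR
    linear_combination (- w ^ 24 + w ^ 23 + 3 * w ^ 19 - 4 * w ^ 18 + w ^ 17 + w ^ 15 - 4 * w ^ 14
      + 6 * w ^ 13 - 6 * w ^ 12 + 5 * w ^ 11 - 5 * w ^ 10 + 3 * w ^ 9 - 3 * w ^ 8 + 6 * w ^ 7 - w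
      ^ 5 - 5 * w ^ 4 + 6 * w ^ 3 - 5 * w ^ 2 + 2 * w) * hw
  have h7 : p ^ 2 * Q + p * q * P + p * r * R + q ^ 2 * R + q * r * Q + r ^ 2 * P = b := by
    subst ha hb hp hq hr hP hQ hR
    linear_combination (w ^ 23 - w ^ 22 - w ^ 16 + 2 * w ^ 15 - 2 * w ^ 14 + 2 * w ^ 13 - 3 * w ^
      12 + 2 * w ^ 11 - w ^ 9 + 2 * w ^ 7 - w ^ 4 + w ^ 3 - w ^ 2) * hw
  have h8 : p ^ 2 * R + p * q * Q + p * r * P + q ^ 2 * P + q * r * R + r ^ 2 * Q = 3 * b := by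
    subst ha hb hp hq hr hP hQ hR
    linear_combination (w ^ 21 - w ^ 20 + w ^ 19 - 2 * w ^ 18 + w ^ 17 + w ^ 16 - w ^ 15 - w ^ 14
      + w ^ 13 - 2 * w ^ 12 + 2 * w ^ 11 - w ^ 10 - w ^ 9 - w ^ 8 + 7 * w ^ 7 - w ^ 6 - 3 * w ^ 5
      + 3 * w ^ 3 - 3 * w ^ 2) * hw
  have h9 : p ^ 2 * P + p * q * R + p * r * Q + q ^ 2 * Q + q * r * P + r ^ 2 * R = -a + b := by
    subst ha hb hp hq hr hP hQ hR
    linear_combination (w ^ 19 - w ^ 18 - w ^ 16 + w ^ 15 + w ^ 13 - 3 * w ^ 12 + 3 * w ^ 11 - 2 *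
      w ^ 10 + w ^ 9 - w ^ 8 + 2 * w ^ 7 - 2 * w ^ 4 + 2 * w ^ 3 - 2 * w ^ 2 + w) * hw
  have h10 : p * Q * R + q * P * R + r * P * Q = 2 * a := by
    subst ha hb hp hq hr hP hQ hR
    linear_combination (- w ^ 18 + 2 * w ^ 17 - w ^ 15 - 2 * w ^ 13 + 3 * w ^ 12 - 2 * w ^ 11 + 2
      * w ^ 10 - w ^ 9 - 2 * w ^ 5 + 4 * w ^ 4 - 2 * w ^ 3 + 2 * w ^ 2 - 2 * w) * hw
  have h11 : p * P * Q + p * R ^ 2 + q * P ^ 2 + q * Q * R + r * P * R + r * Q ^ 2 = -a := by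
    subst ha hb hp hq hr hP hQ hR
    linear_combination (w ^ 15 - 4 * w ^ 14 + 5 * w ^ 13 - 2 * w ^ 12 + w ^ 11 - 2 * w ^ 10 + w ^
      9 + w ^ 5 - 2 * w ^ 4 + w ^ 3 - w ^ 2 + w) * hw
  have h12 : p * P * R + p * Q ^ 2 + q * P * Q + q * R ^ 2 + r * P ^ 2 + r * Q * R = -3 * a := by
    subst ha hb hp hq hr hP hQ hR
    linear_combination (- w ^ 22 + w ^ 21 - w ^ 17 + w ^ 16 + w ^ 14 + 2 * w ^ 13 - 3 * w ^ 12 + 2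
      * w ^ 11 - 5 * w ^ 10 + 3 * w ^ 9 - w ^ 6 + 4 * w ^ 5 - 6 * w ^ 4 + 3 * w ^ 3 - 3 * w ^ 2 +
      3 * w) * hw
  have h13 : p * P * R + q * P * Q + r * Q * R = -b := by
    subst ha hb hp hq hr hP hQ hR
    linear_combination (- w ^ 17 + w ^ 16 + w ^ 14 - w ^ 13 + w ^ 12 - 2 * w ^ 11 + w ^ 10 + w ^ 9
      - 2 * w ^ 7 + w ^ 5 - w ^ 3 + w ^ 2) * hw
  have h14 : p * P ^ 2 + p * Q * R + q * P * R + q * Q ^ 2 + r * P * Q + r * R ^ 2 = -a - b := by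
    subst ha hb hp hq hr hP hQ hR
    linear_combination (- w ^ 20 + w ^ 19 - w ^ 18 + 2 * w ^ 17 - w ^ 16 + w ^ 13 + w ^ 11 - 4 * w
      ^ 10 + 3 * w ^ 9 - w ^ 8 - w ^ 7 + 2 * w ^ 5 - 2 * w ^ 4 + w) * hw
  have h15 : p * P * Q + q * Q * R + r * P * R = a - b := by
    subst ha hb hp hq hr hP hQ hR
    linear_combination (- w ^ 19 + w ^ 18 + w ^ 15 - w ^ 14 + w ^ 12 - 2 * w ^ 11 + 2 * w ^ 10 - w
      ^ 9 + w ^ 8 - 2 * w ^ 7 + 2 * w ^ 4 - 2 * w ^ 3 + 2 * w ^ 2 - w) * hw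
  have h16 : P * Q * R = a := by
    subst ha hb hp hq hr hP hQ hR
    linear_combination (w ^ 14 - 2 * w ^ 13 + w ^ 12 - w ^ 11 + 2 * w ^ 10 - w ^ 9 - w ^ 5 + 2 * w
      ^ 4 - w ^ 3 + w ^ 2 - w) * hw
  have h17 : P ^ 2 * Q + P * R ^ 2 + Q ^ 2 * R = a + b := by
    subst ha hb hp hq hr hP hQ hR
    linear_combination (w ^ 17 - 2 * w ^ 16 + 2 * w ^ 15 - w ^ 14 - 2 * w ^ 12 + 2 * w ^ 11 + w ^
      10 - 2 * w ^ 9 + 2 * w ^ 7 - 2 * w ^ 5 + 2 * w ^ 4 - w) * hw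
  have h18 : P ^ 2 * R + P * Q ^ 2 + Q * R ^ 2 = -2 * a + 2 * b := by
    subst ha hb hp hq hr hP hQ hR
    linear_combination (w ^ 18 - w ^ 17 - w ^ 15 + w ^ 14 + w ^ 13 - 3 * w ^ 12 + 4 * w ^ 11 - 3 *
      w ^ 10 - w ^ 9 + 4 * w ^ 7 - 4 * w ^ 4 + 4 * w ^ 3 - 4 * w ^ 2 + 2 * w) * hw
  have h19 : P ^ 3 + 3 * P * Q * R + Q ^ 3 + R ^ 3 = 3 * a + 2 * b := by
    subst ha hb hp hq hr hP hQ hR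
    linear_combination (w ^ 21 - w ^ 20 + 3 * w ^ 14 - 6 * w ^ 13 + w ^ 12 - w ^ 11 + 6 * w ^ 10 -
      5 * w ^ 9 + 5 * w ^ 7 - w ^ 6 - 5 * w ^ 5 + 6 * w ^ 4 - w ^ 3 + w ^ 2 - 3 * w) * hw
  simp only [← hp, ← hq, ← hr, ← hP, ← hQ, ← hR]
  clear ha hb hp hq hr hP hQ hR hw
  linear_combination (x0 ^ 3 + x1 ^ 3 + x2 ^ 3) * h0 + (x0 ^ 2 * x1 + x0 * x2 ^ 2 + x1 ^ 2 * x2) *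
    h1 + (x0 ^ 2 * x2 + x0 * x1 ^ 2 + x1 * x2 ^ 2) * h2 + (x0 ^ 2 * x3 + x1 ^ 2 * x4 + x2 ^ 2 *
    x5) * h3 + (x0 ^ 2 * x4 + x1 ^ 2 * x5 + x2 ^ 2 * x3) * h4 + (x0 ^ 2 * x5 + x1 ^ 2 * x3 + x2 ^
    2 * x4) * h5 + x0 * x1 * x2 * h6 + (x0 * x1 * x3 + x0 * x2 * x5 + x1 * x2 * x4) * h7 + (x0 *
    x1 * x4 + x0 * x2 * x3 + x1 * x2 * x5) * h8 + (x0 * x1 * x5 + x0 * x2 * x4 + x1 * x2 * x3) *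
    h9 + (x0 * x3 ^ 2 + x1 * x4 ^ 2 + x2 * x5 ^ 2) * h10 + (x0 * x3 * x4 + x1 * x4 * x5 + x2 * x3
    * x5) * h11 + (x0 * x3 * x5 + x1 * x3 * x4 + x2 * x4 * x5) * h12 + (x0 * x4 ^ 2 + x1 * x5 ^ 2
    + x2 * x3 ^ 2) * h13 + (x0 * x4 * x5 + x1 * x3 * x5 + x2 * x3 * x4) * h14 + (x0 * x5 ^ 2 + x1
    * x3 ^ 2 + x2 * x4 ^ 2) * h15 + (x3 ^ 3 + x4 ^ 3 + x5 ^ 3) * h16 + (x3 ^ 2 * x4 + x3 * x5 ^ 2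
    + x4 ^ 2 * x5) * h17 + (x3 ^ 2 * x5 + x3 * x4 ^ 2 + x4 * x5 ^ 2) * h18 + x3 * x4 * x5 * h19

lemma Dinf_sineMap_eq {w : ℂ} (hw : w ^ 13 = 1) (v : Fin 6 → ℂ) :
    Dinf (sineMap w v) = D 0 (sineMap (w ^ 8) v) := by
  have h (k : ℕ) : (w ^ 8) ^ k = w ^ (8 * k % 13) := by rw [← pow_mul, pow_eq_pow_mod _ hw]
  simp only [D, Dinf, sineMap, Matrix.cons_val, h, Nat.reduceMul, Nat.reduceMod, pow_one]

lemma Dinf_sineMap {w a b : ℂ} (hw : w ^ 13 = 1) (hw1 : w ≠ 1)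
    (ha : a = w + w ^ 3 + w ^ 9 - w ^ 4 - w ^ 12 - w ^ 10)
    (hb : b = w ^ 2 + w ^ 6 + w ^ 5 - w ^ 8 - w ^ 11 - w ^ 7) (v : Fin 6 → ℂ) :
    Dinf (sineMap w v) =
      (3 * a + 2 * b) * D 0 v + (2 * a - 3 * b) * Dinf v - (a - b) * (D 1 v + D 3 v + D 9 v) +
        b * (D 2 v + D 5 v + D 6 v) - (a + b) * (D 4 v + D 10 v + D 12 v) -
        a * (D 7 v + D 8 v + D 11 v) := by
  have h (k : ℕ) : (w ^ 8) ^ k = w ^ (8 * k % 13) := by rw [← pow_mul, pow_eq_pow_mod _ hw]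
  have h8 : w ^ 8 ≠ 1 := fun h8 ↦ hw1 <| by
    have := h 5
    rw [h8] at this
    simpa using this.symm
  rw [Dinf_sineMap_eq hw, D_zero_sineMap (w := w ^ 8) (a := -b) (b := a)
    (geom_sum_eq_zero_expanded (by rw [h]; simp) h8)
    (by simp only [h, Nat.reduceMul, Nat.reduceMod, hb]; ring)
    (by simp only [h, Nat.reduceMul, Nat.reduceMod, pow_one, ha]; ring)]
  ring

lemma cubicPeriod_sq_add_sq {w : ℂ}
    (hw : 1 + w + w ^ 2 + w ^ 3 + w ^ 4 + w ^ 5 + w ^ 6 + w ^ 7 + w ^ 8 + w ^ 9 + w ^ 10 + w ^ 11 +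
      w ^ 12 = 0) :
    (w + w ^ 3 + w ^ 9 - w ^ 4 - w ^ 12 - w ^ 10) ^ 2 +
      (w ^ 2 + w ^ 6 + w ^ 5 - w ^ 8 - w ^ 11 - w ^ 7) ^ 2 = -13 := by
  linear_combination (
      w ^ 12 - w ^ 11 + 3 * w ^ 10 - 5 * w ^ 9 + 3 * w ^ 8 - w ^ 7 + 3 * w ^ 6 - 5 * w ^ 5 + 3 * w
        ^ 4 - w ^ 3 + w ^ 2 - 13 * w + 13) * hw

lemma Gs_zero_sineMap {w : ℂ} (hw : w ^ 13 = 1) (hw1 : w ≠ 1) (v : Fin 6 → ℂ) :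
    Gs 0 (sineMap w v) = 13 * deltaF 0 v := by
  have hΦ := geom_sum_eq_zero_expanded hw hw1
  have hsq := cubicPeriod_sq_add_sq hΦ
  have h0 := D_zero_sineMap hΦ rfl rfl v
  have h1 := Dinf_sineMap hw hw1 rfl rfl v
  rw [Gs, h0, h1]
  clear h0 h1
  generalize w + w ^ 3 + w ^ 9 - w ^ 4 - w ^ 12 - w ^ 10 = a at hsq ⊢
  generalize w ^ 2 + w ^ 6 + w ^ 5 - w ^ 8 - w ^ 11 - w ^ 7 = b at hsq ⊢
  rw [deltaF, ← Finset.Ico_succ_right_eq_Icc]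
  simp only [Finset.sum_Ico_eq_sum_range, Nat.succ_eq_succ, Finset.sum_range_succ,
    Finset.sum_range_zero, mul_zero, pow_zero, one_mul, zero_add, Gs, Nat.reduceAdd]
  generalize D 0 v = d0, D 1 v = d1, D 2 v = d2, D 3 v = d3, D 4 v = d4, D 5 v = d5, D 6 v = d6,
    D 7 v = d7, D 8 v = d8, D 9 v = d9, D 10 v = d10, D 11 v = d11, D 12 v = d12, Dinf v = di
  linear_combination (
      (-2 * d0 + 3 * di - 1 * (d1 + d3 + d9) - 1 * (d2 + d5 + d6) + 1 *
        (d4 + d10 + d12)) ^ 2 + (3 * d0 + 2 * di - 1 * (d1 + d3 + d9) - 1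
        * (d4 + d10 + d12) - 1 * (d7 + d8 + d11)) ^ 2) * hsq

/-- The diagonal action of `T` twisted by a root of unity `ω`. -/
def diagScale (ω : ℂ) (v : Fin 6 → ℂ) : Fin 6 → ℂ :=
  ![ω ^ 7 * v 0, ω ^ 11 * v 1, ω ^ 8 * v 2, ω ^ 6 * v 3, ω ^ 2 * v 4, ω ^ 5 * v 5]

lemma Dinf_diagScale {ω : ℂ} (hω : ω ^ 13 = 1) (v : Fin 6 → ℂ) :
    Dinf (diagScale ω v) = Dinf v := by
  simp only [Dinf, diagScale, Matrix.cons_val]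
  linear_combination (1 * (1) * (v 3 * v 4 * v 5)) * hω

lemma D_diagScale {ω : ℂ} (hω : ω ^ 13 = 1) (v : Fin 6 → ℂ) (j : ℕ) :
    D j (diagScale ω v) = ω ^ j * D j v := by
  match j with
  | 0 =>
    simp only [D, diagScale, Matrix.cons_val]
    linear_combination (1 * (1 + ω ^ 13) * (v 0 * v 1 * v 2)) * hω
  | 1 =>
    simp only [D, diagScale, Matrix.cons_val]
    linear_combination (2 * (ω ^ 1 + ω ^ 14) * (v 1 * v 2 ^ 2) + 1 * (ω ^ 1 + ω ^ 14) * (v 1 ^ 2 *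
      v 5) + -1 * (ω ^ 1) * (v 3 ^ 2 * v 4) + 1 * (ω ^ 1) * (v 0 * v 4 * v 5)) * hω
  | 2 =>
    simp only [D, diagScale, Matrix.cons_val]
    linear_combination (-1 * (ω ^ 2) * (v 5 ^ 3) + 1 * (ω ^ 2 + ω ^ 15) * (v 1 ^ 2 * v 3) + -2 *
      (ω ^ 2) * (v 1 * v 4 ^ 2) + 1 * (ω ^ 2) * (v 0 * v 3 * v 4) + 3 * (ω ^ 2) * (v 2 * v 4 * v
      5)) * hω
  | 3 =>
    simp only [D, diagScale, Matrix.cons_val]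
    linear_combination (2 * (ω ^ 3 + ω ^ 16) * (v 0 * v 1 ^ 2) + 1 * (ω ^ 3) * (v 0 ^ 2 * v 4) +
      -1 * (ω ^ 3) * (v 3 * v 5 ^ 2) + 1 * (ω ^ 3) * (v 2 * v 3 * v 4)) * hω
  | 4 =>
    simp only [D, diagScale, Matrix.cons_val]
    linear_combination (-1 * (ω ^ 4 + ω ^ 17) * (v 1 ^ 2 * v 2) + 1 * (ω ^ 4) * (v 0 * v 5 ^ 2) +
      -2 * (ω ^ 4) * (v 3 ^ 2 * v 5) + -1 * (ω ^ 4) * (v 0 * v 2 * v 4)) * hω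
  | 5 =>
    simp only [D, diagScale, Matrix.cons_val]
    linear_combination (-1 * (ω ^ 5) * (v 3 ^ 3) + 1 * (ω ^ 5) * (v 2 ^ 2 * v 4) + -2 * (ω ^ 5) *
      (v 2 * v 5 ^ 2) + 1 * (ω ^ 5) * (v 1 * v 4 * v 5) + 3 * (ω ^ 5) * (v 0 * v 3 * v 5)) * hω
  | 6 =>
    simp only [D, diagScale, Matrix.cons_val]
    linear_combination (1 * (ω ^ 6) * (v 0 ^ 2 * v 5) + -2 * (ω ^ 6) * (v 0 * v 3 ^ 2) + 1 * (ω ^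
      6) * (v 2 * v 3 * v 5) + 3 * (ω ^ 6) * (v 1 * v 3 * v 4)) * hω
  | 7 =>
    simp only [D, diagScale, Matrix.cons_val]
    linear_combination (-1 * (ω ^ 7 + ω ^ 20) * (v 1 ^ 3) + 1 * (ω ^ 7) * (v 2 * v 3 ^ 2) + -1 *
      (ω ^ 7) * (v 0 * v 2 * v 5) + -3 * (ω ^ 7) * (v 0 * v 1 * v 4) + 2 * (ω ^ 7) * (v 0 ^ 2 * v
      3)) * hω
  | 8 =>
    simp only [D, diagScale, Matrix.cons_val]
    linear_combination (-1 * (ω ^ 8) * (v 0 ^ 3) + 1 * (ω ^ 8) * (v 1 * v 5 ^ 2) + -1 * (ω ^ 8) *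
      (v 1 * v 2 * v 4) + -3 * (ω ^ 8) * (v 0 * v 2 * v 3) + 2 * (ω ^ 8) * (v 2 ^ 2 * v 5)) * hω
  | 9 =>
    simp only [D, diagScale, Matrix.cons_val]
    linear_combination (2 * (ω ^ 9) * (v 0 ^ 2 * v 2) + 1 * (ω ^ 9) * (v 2 ^ 2 * v 3) + 1 * (ω ^
      9) * (v 1 * v 3 * v 5)) * hω
  | 10 =>
    simp only [D, diagScale, Matrix.cons_val]
    linear_combination (-1 * (ω ^ 10) * (v 0 * v 2 ^ 2) + 1 * (ω ^ 10) * (v 1 * v 3 ^ 2) + -1 * (ω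
      ^ 10) * (v 0 * v 1 * v 5)) * hω
  | 11 =>
    simp only [D, diagScale, Matrix.cons_val]
    linear_combination (-1 * (ω ^ 11) * (v 2 ^ 3) + -1 * (ω ^ 11) * (v 0 * v 1 * v 3) + -3 * (ω ^
      11) * (v 1 * v 2 * v 5) + 2 * (ω ^ 11) * (v 1 ^ 2 * v 4)) * hω
  | 12 =>
    simp only [D, diagScale, Matrix.cons_val]
    linear_combination (-1 * (ω ^ 12) * (v 0 ^ 2 * v 1) + -1 * (ω ^ 12) * (v 1 * v 2 * v 3)) * hω
  | n + 13 => simp [D]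

lemma Gs_diagScale {ω : ℂ} (hω : ω ^ 13 = 1) (v : Fin 6 → ℂ) (j : ℕ) :
    Gs j (diagScale ω v) = ω ^ j * Gs j v := by
  match j with
  | 0 =>
    simp only [Gs, D_diagScale hω, Dinf_diagScale hω]
    ring
  | 1 =>
    simp only [Gs, D_diagScale hω, Dinf_diagScale hω]
    linear_combination ω ^ 1 * (- 1 * D 7 v * D 7 v + 2 * D 2 v * D 12 v - 2 * D 3 v * D 11 v - 4
      * D 4 v * D 10 v - 2 * D 9 v * D 5 v) * hω
  | 2 =>
    simp only [Gs, D_diagScale hω, Dinf_diagScale hω]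
    linear_combination ω ^ 2 * (- 2 * D 4 v * D 11 v + 2 * D 5 v * D 10 v - 2 * D 6 v * D 9 v - 2
      * D 7 v * D 8 v) * hω
  | 3 =>
    simp only [Gs, D_diagScale hω, Dinf_diagScale hω]
    linear_combination ω ^ 3 * (- 1 * D 8 v * D 8 v + 2 * D 6 v * D 10 v - 2 * D 9 v * D 7 v - 4 *
      D 12 v * D 4 v) * hω
  | 4 =>
    simp only [Gs, D_diagScale hω, Dinf_diagScale hω]
    linear_combination ω ^ 4 * (2 * D 5 v * D 12 v - 2 * D 9 v * D 8 v - 2 * D 10 v * D 7 v) * hω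
  | 5 =>
    simp only [Gs, D_diagScale hω, Dinf_diagScale hω]
    linear_combination ω ^ 5 * (- 2 * D 9 v * D 9 v - 2 * D 10 v * D 8 v + 2 * D 6 v * D 12 v - 2
      * D 11 v * D 7 v) * hω
  | 6 =>
    simp only [Gs, D_diagScale hω, Dinf_diagScale hω]
    linear_combination ω ^ 6 * (- 2 * D 12 v * D 7 v - 2 * D 8 v * D 11 v) * hω
  | 7 =>
    simp only [Gs, D_diagScale hω, Dinf_diagScale hω]
    linear_combination ω ^ 7 * (- 2 * D 10 v * D 10 v - 2 * D 8 v * D 12 v - 2 * D 9 v * D 11 v) *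
      hω
  | 8 =>
    simp only [Gs, D_diagScale hω, Dinf_diagScale hω]
    linear_combination ω ^ 8 * (- 2 * D 11 v * D 10 v) * hω
  | 9 =>
    simp only [Gs, D_diagScale hω, Dinf_diagScale hω]
    linear_combination ω ^ 9 * (- 1 * D 11 v * D 11 v - 4 * D 10 v * D 12 v) * hω
  | 10 =>
    simp only [Gs, D_diagScale hω, Dinf_diagScale hω]
    linear_combination ω ^ 10 * (- 2 * D 12 v * D 11 v) * hω
  | 11 =>
    simp only [Gs, D_diagScale hω, Dinf_diagScale hω]
    linear_combination ω ^ 11 * (- 2 * D 12 v * D 12 v) * hω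
  | 12 =>
    simp only [Gs, D_diagScale hω, Dinf_diagScale hω]
    ring
  | n + 13 => simp [Gs]

instance : Fact (Nat.Prime 13) := ⟨by norm_num⟩

/-- The additive character `k ↦ ζ ^ k` of `ZMod 13`. -/
abbrev chi : AddChar (ZMod 13) ℂ := ZMod.stdAddChar

/-- The six coordinates of an odd function on `ZMod 13`. -/
def coords (b : ZMod 13 → ℂ) : Fin 6 → ℂ := ![b 12, b 10, b 4, b 5, b 2, b 6]

/-- Multiplication by the Gaussian `r ↦ ζ ^ (ν r² / 2)`. -/
def twist (ν : ZMod 13) (b : ZMod 13 → ℂ) : ZMod 13 → ℂ := fun r ↦ chi (7 * ν * r ^ 2) * b r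

lemma zeta13_eq_chi : ζ = chi 1 := by
  rw [chi, ← Int.cast_one, ZMod.stdAddChar_coe, zeta13]
  norm_num

lemma chi_pow_thirteen (ν : ZMod 13) : chi ν ^ 13 = 1 := by
  rw [← AddChar.map_nsmul_eq_pow]
  simp [show (13 : ZMod 13) = 0 from rfl]

lemma chi_ne_one {ν : ZMod 13} (hν : ν ≠ 0) : chi ν ≠ 1 := fun h ↦
  hν <| ZMod.injective_stdAddChar (h.trans (AddChar.map_zero_eq_one _).symm)

lemma zeta13_pow_val (ν : ZMod 13) (j : ℕ) : ζ ^ (j * ν.val) = chi ν ^ j := by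
  rw [zeta13_eq_chi, mul_comm, pow_mul, ← AddChar.map_nsmul_eq_pow]
  simp

lemma coords_twist (ν : ZMod 13) (b : ZMod 13 → ℂ) :
    coords (twist ν b) = diagScale (chi ν) (coords b) := by
  have h (r : ZMod 13) : chi (7 * ν * r ^ 2) = chi ν ^ (7 * r ^ 2).val := by
    rw [← AddChar.map_nsmul_eq_pow]
    congr 1
    simp only [nsmul_eq_mul, ZMod.natCast_val, ZMod.cast_id', id_eq]
    ring
  simp only [coords, twist, diagScale, h, Matrix.cons_val]
  rfl

lemma deltaF_val (ν : ZMod 13) (v : Fin 6 → ℂ) :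
    deltaF ν.val v = deltaF 0 (diagScale (chi ν) v) := by
  simp only [deltaF, zeta13_pow_val, mul_zero, pow_zero, one_mul,
    Gs_diagScale (chi_pow_thirteen ν)]

/-- Symmetry of `Gs 0` under the scaling action of `(ZMod 13)ˣ`. -/
lemma Gs_zero_coords_comp_mul {b : ZMod 13 → ℂ} (hb : b.Odd) {k : ZMod 13} (hk : k ≠ 0) :
    Gs 0 (coords fun r ↦ b (k * r)) = Gs 0 (coords b) := by
  obtain ⟨n, rfl⟩ : ∃ n : Fin 12, k = 2 ^ n.val := by revert k; decide
  generalize n.val = n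
  clear hk
  induction n generalizing b with
  | zero => simp
  | succ n ih =>
    have h2 : Function.Odd fun r ↦ b (2 * r) := fun r ↦ by simp [hb (2 * r)]
    have := ih h2
    simp only [pow_succ', mul_assoc]
    rw [this]
    have e1 := hb 2
    have e2 := hb 6
    have e3 := hb 5
    simp only [Gs, D, Dinf, coords, Matrix.cons_val]
    rw [show (2 * 12 : ZMod 13) = -2 from rfl, show (2 * 10 : ZMod 13) = -6 from rfl,
      show (2 * 4 : ZMod 13) = -5 from rfl, show (2 * 5 : ZMod 13) = 10 from rfl,
      show (2 * 2 : ZMod 13) = 4 from rfl, show (2 * 6 : ZMod 13) = 12 from rfl, e1, e2, e3]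
    ring

lemma Gs_smul (c : ℂ) (v : Fin 6 → ℂ) (j : ℕ) : Gs j (c • v) = c ^ 6 * Gs j v := by
  have hI : Dinf (c • v) = c ^ 3 * Dinf v := by
    simp only [Dinf, Pi.smul_apply, smul_eq_mul]; ring
  have hD (j : ℕ) : D j (c • v) = c ^ 3 * D j v := by
    match j with
    | 0 | 1 | 2 | 3 | 4 | 5 | 6 | 7 | 8 | 9 | 10 | 11 | 12 =>
      simp only [D, Pi.smul_apply, smul_eq_mul]; ring
    | n + 13 => simp [D]
  match j with
  | 0 | 1 | 2 | 3 | 4 | 5 | 6 | 7 | 8 | 9 | 10 | 11 | 12 => simp only [Gs, hI, hD]; ring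
  | n + 13 => simp [Gs]

lemma deltaF_smul (c : ℂ) (v : Fin 6 → ℂ) (ν : ℕ) : deltaF ν (c • v) = c ^ 6 * deltaF ν v := by
  simp only [deltaF, Gs_smul, mul_add, Finset.mul_sum]
  congr 1
  · ring
  · exact Finset.sum_congr rfl fun _ _ ↦ by ring

lemma Phi18_smul (c : ℂ) (v : Fin 6 → ℂ) : Phi18 (c • v) = c ^ 18 * Phi18 v := by
  simp only [Phi18, deltaF_smul, deltaInf, Gs_smul, mul_pow, ← Finset.mul_sum]
  ring

lemma Phi18_eq_sum_zmod (v : Fin 6 → ℂ) :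
    Phi18 v = 1 / (13 * 6) * (∑ ν : ZMod 13, deltaF ν.val v ^ 3 + deltaInf v ^ 3) := by
  rw [Phi18, Finset.sum_range]
  rfl

lemma dft_odd {b : ZMod 13 → ℂ} (hb : b.Odd) : (𝓕 b).Odd := by
  rwa [ZMod.dft_odd_iff]

lemma sum_zmod_thirteen (f : ZMod 13 → ℂ) :
    ∑ j, f j = f 0 + f 1 + f 2 + f 3 + f 4 + f 5 + f 6 + f 7 + f 8 + f 9 + f 10 + f 11 + f 12 := by
  refine (Fin.sum_univ_castSucc (n := 12) f).trans ?_
  simp only [Fin.sum_univ_castSucc, Fin.sum_univ_zero, zero_add]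
  rfl

lemma coords_dft {b : ZMod 13 → ℂ} (hb : b.Odd) :
    coords (𝓕 b) = sineMap (chi (-1)) (coords b) := by
  have h (k : ZMod 13) : chi (-k) = chi (-1) ^ k.val := by
    rw [← AddChar.map_nsmul_eq_pow]
    simp
  have h0 : b 0 = 0 := by simpa [self_eq_neg] using hb 0
  have e (s : ZMod 13) : b s = - b (-s) := by rw [hb, neg_neg]
  have key (k : ZMod 13) : 𝓕 b k = ∑ j : ZMod 13, chi (-1) ^ (j * k).val * b j := by
    simp only [ZMod.dft_apply, ← h, smul_eq_mul]
  have key2 (k : ZMod 13) : 𝓕 b k = chi (-1) ^ (12 * k).val * b 12 +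
      chi (-1) ^ (10 * k).val * b 10 + chi (-1) ^ (4 * k).val * b 4 +
      chi (-1) ^ (5 * k).val * b 5 + chi (-1) ^ (2 * k).val * b 2 +
      chi (-1) ^ (6 * k).val * b 6 - (chi (-1) ^ (1 * k).val * b 12 +
      chi (-1) ^ (3 * k).val * b 10 + chi (-1) ^ (9 * k).val * b 4 +
      chi (-1) ^ (8 * k).val * b 5 + chi (-1) ^ (11 * k).val * b 2 +
      chi (-1) ^ (7 * k).val * b 6) := by
    rw [key]
    rw [sum_zmod_thirteen, h0, e 1, e 3, e 9, e 8, e 11, e 7, show -(1 : ZMod 13) = 12 from rfl,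
      show -(3 : ZMod 13) = 10 from rfl, show -(9 : ZMod 13) = 4 from rfl,
      show -(8 : ZMod 13) = 5 from rfl, show -(11 : ZMod 13) = 2 from rfl,
      show -(7 : ZMod 13) = 6 from rfl]
    ring
  generalize chi (-1) = w at key2
  have c1 : coords (𝓕 b) = ![𝓕 b 12, 𝓕 b 10, 𝓕 b 4, 𝓕 b 5, 𝓕 b 2, 𝓕 b 6] := rfl
  rw [c1]
  simp only [key2, sineMap, coords, Matrix.cons_val, ZMod.val_mul, ZMod.val_ofNat,
    ZMod.val_one, Nat.reduceMul, Nat.reduceMod, pow_one]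
  iterate 5
    congr 1
    · ring
  congr 1
  ring

/-- The quadratic Gauss sum `∑ y, ζ ^ (ν y² / 2)`. -/
def quadGauss (ν : ZMod 13) : ℂ := ∑ y : ZMod 13, chi (7 * ν * y ^ 2)

lemma quadGauss_sq {ν : ZMod 13} (hν : ν ≠ 0) : quadGauss ν ^ 2 = 13 := by
  have h7 : 7 * ν ≠ 0 := mul_ne_zero (by decide) hν
  have hω := geom_sum_eq_zero_expanded (chi_pow_thirteen _) (chi_ne_one h7)
  have h (y : ZMod 13) : chi (7 * ν * y ^ 2) = chi (7 * ν) ^ (y ^ 2).val := by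
    rw [← AddChar.map_nsmul_eq_pow]
    congr 1
    simp only [nsmul_eq_mul, ZMod.natCast_val, ZMod.cast_id', id_eq]
    ring
  have : quadGauss ν = chi (7 * ν) ^ 0 + 2 * (chi (7 * ν) ^ 1 + chi (7 * ν) ^ 4 + chi (7 * ν) ^ 9 +
      chi (7 * ν) ^ 3 + chi (7 * ν) ^ 12 + chi (7 * ν) ^ 10) := by
    simp only [quadGauss, h]
    rw [sum_zmod_thirteen]
    change _ ^ 0 + _ ^ 1 + _ ^ 4 + _ ^ 9 + _ ^ 3 + _ ^ 12 + _ ^ 10 + _ ^ 10 + _ ^ 12 + _ ^ 3 +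
      _ ^ 9 + _ ^ 4 + _ ^ 1 = _
    ring
  rw [this]
  generalize chi (7 * ν) = u at hω
  linear_combination (4 * u ^ 12 - 4 * u ^ 11 + 8 * u ^ 10 - 4 * u ^ 8 + 4 * u ^ 7 - 4 * u ^ 6 -
    4 * u ^ 5 + 8 * u ^ 4 + 16 * u - 12) * hω

/-- The relation `S Tᵛ S = T^(-1/ν) S M T^(-1/ν)` in the Weil representation on functions on
`ZMod 13`. -/
lemma dft_twist_dft {ν : ZMod 13} (hν : ν ≠ 0) (b : ZMod 13 → ℂ) :
    𝓕 (twist ν (𝓕 b)) =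
      quadGauss ν • twist (-ν⁻¹) (fun r ↦ 𝓕 (twist (-ν⁻¹) b) (ν⁻¹ * r)) := by
  ext k
  have key (s : ZMod 13) : ∑ j : ZMod 13, chi (7 * ν * j ^ 2 - j * (k + s)) =
      quadGauss ν * chi (7 * (-ν⁻¹) * (k + s) ^ 2) := by
    rw [quadGauss, Finset.sum_mul, ← Equiv.sum_comp (Equiv.addRight (ν⁻¹ * (k + s)))]
    refine Finset.sum_congr rfl fun j _ ↦ ?_
    rw [← AddChar.map_add_eq_mul]
    congr 1
    have h14 : (14 : ZMod 13) = 1 := rfl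
    have hi : ν * ν⁻¹ = 1 := mul_inv_cancel₀ hν
    simp only [Equiv.coe_addRight]
    linear_combination (14 * j * (k + s) + 7 * ν⁻¹ * (k + s) ^ 2) * hi +
      (j * (k + s) + ν⁻¹ * (k + s) ^ 2) * h14
  simp only [ZMod.dft_apply, twist, Pi.smul_apply, smul_eq_mul, Finset.mul_sum]
  rw [Finset.sum_comm]
  refine Finset.sum_congr rfl fun s _ ↦ ?_
  have h14 : (14 : ZMod 13) = 1 := rfl
  have e1 : chi (7 * (-ν⁻¹) * (k + s) ^ 2) = chi (7 * -ν⁻¹ * k ^ 2) * chi (-(s * (ν⁻¹ * k))) *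
      chi (7 * -ν⁻¹ * s ^ 2) := by
    simp only [← AddChar.map_add_eq_mul]
    congr 1
    linear_combination - ν⁻¹ * s * k * h14
  calc _ = (∑ j : ZMod 13, chi (7 * ν * j ^ 2 - j * (k + s))) * b s := by
        rw [Finset.sum_mul]
        refine Finset.sum_congr rfl fun j _ ↦ ?_
        have : chi (7 * ν * j ^ 2 - j * (k + s)) =
            chi (-(j * k)) * chi (7 * ν * j ^ 2) * chi (-(s * j)) := by
          simp only [← AddChar.map_add_eq_mul]
          congr 1
          ring
        rw [this]
        ring
    _ = _ := by
        rw [key, e1]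
        ring

lemma twist_odd {b : ZMod 13 → ℂ} (hb : b.Odd) (ν : ZMod 13) : (twist ν b).Odd := fun r ↦ by
  simp [twist, hb r]

lemma coords_smul (c : ℂ) (b : ZMod 13 → ℂ) : coords (c • b) = c • coords b := by
  simp [coords]

lemma Gs_zero_coords_dft {b : ZMod 13 → ℂ} (hb : b.Odd) :
    Gs 0 (coords (𝓕 b)) = 13 * deltaF 0 (coords b) := by
  rw [coords_dft hb, Gs_zero_sineMap (chi_pow_thirteen _) (chi_ne_one (by decide))]

lemma thirteen_mul_deltaF_val {b : ZMod 13 → ℂ} (hb : b.Odd) (ν : ZMod 13) :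
    13 * deltaF ν.val (coords b) = Gs 0 (coords (𝓕 (twist ν b))) := by
  rw [Gs_zero_coords_dft (twist_odd hb ν), coords_twist, deltaF_val]

lemma Gs_zero_coords_twist (ν : ZMod 13) (b : ZMod 13 → ℂ) :
    Gs 0 (coords (twist ν b)) = Gs 0 (coords b) := by
  rw [coords_twist, Gs_diagScale (chi_pow_thirteen ν), pow_zero, one_mul]

lemma deltaF_coords_dft {b : ZMod 13 → ℂ} (hb : b.Odd) {ν : ZMod 13} (hν : ν ≠ 0) :
    deltaF ν.val (coords (𝓕 b)) = 13 ^ 3 * deltaF (-ν⁻¹).val (coords b) := by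
  have h13 : (13 : ℂ) ≠ 0 := by norm_num
  refine mul_left_cancel₀ h13 ?_
  rw [thirteen_mul_deltaF_val (dft_odd hb), dft_twist_dft hν, coords_smul, Gs_smul,
    Gs_zero_coords_twist, Gs_zero_coords_comp_mul (dft_odd (twist_odd hb _)) (inv_ne_zero hν),
    ← thirteen_mul_deltaF_val hb, show quadGauss ν ^ 6 = (quadGauss ν ^ 2) ^ 3 by ring,
    quadGauss_sq hν]
  ring

lemma deltaF_zero_coords_dft {b : ZMod 13 → ℂ} (hb : b.Odd) :
    deltaF 0 (coords (𝓕 b)) = 13 ^ 3 * deltaInf (coords b) := by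
  have h13 : (13 : ℂ) ≠ 0 := by norm_num
  refine mul_left_cancel₀ h13 ?_
  rw [← Gs_zero_coords_dft (dft_odd hb), ZMod.dft_dft,
    show (fun j : ZMod 13 ↦ ((13 : ℕ) : ℂ) • b (-j)) = (-13 : ℂ) • b by
      ext j; simp [hb j], coords_smul, Gs_smul, deltaInf]
  ring

lemma Phi18_coords_dft {b : ZMod 13 → ℂ} (hb : b.Odd) :
    Phi18 (coords (𝓕 b)) = 13 ^ 9 * Phi18 (coords b) := by
  have key : ∑ ν ∈ univ.erase (0 : ZMod 13), deltaF ν.val (coords (𝓕 b)) ^ 3 =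
      13 ^ 9 * ∑ ν ∈ univ.erase (0 : ZMod 13), deltaF ν.val (coords b) ^ 3 := by
    rw [Finset.mul_sum]
    refine Finset.sum_bij' (fun ν _ ↦ -ν⁻¹) (fun ν _ ↦ -ν⁻¹) (by simp) (by simp)
      (by simp [inv_neg]) (by simp [inv_neg]) fun ν hν ↦ ?_
    rw [deltaF_coords_dft hb (Finset.ne_of_mem_erase hν)]
    ring
  simp only [Phi18_eq_sum_zmod, ← Finset.add_sum_erase _ _ (Finset.mem_univ (0 : ZMod 13)), key,
    ZMod.val_zero, deltaF_zero_coords_dft hb]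
  simp only [deltaInf, Gs_zero_coords_dft hb]
  ring

lemma Phi18_coords_twist_one (b : ZMod 13 → ℂ) :
    Phi18 (coords (twist 1 b)) = Phi18 (coords b) := by
  have h := Equiv.sum_comp (Equiv.addRight (1 : ZMod 13)) fun ν ↦ deltaF ν.val (coords b) ^ 3
  rw [Phi18_eq_sum_zmod, Phi18_eq_sum_zmod, deltaInf, deltaInf, Gs_zero_coords_twist, ← h]
  congr! 4 with ν
  rw [deltaF_val, deltaF_val, ← coords_twist, ← coords_twist]
  congr 2
  ext r
  simp only [twist, Equiv.coe_addRight, ← mul_assoc, ← AddChar.map_add_eq_mul]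
  ring_nf

/-- The summand `(-1)ⁿ q^((13 - 2n)² / 104)` of the theta constants of order `13`. -/
def oddTerm (z : ℂ) (n : ℤ) : ℂ := (-1) ^ n * cexp (2 * π * I * z * (13 - 2 * n) ^ 2 / 104)

/-- The theta constants of order `13` as an odd function on `ZMod 13`. -/
def residueTheta (z : ℂ) (r : ZMod 13) : ℂ := ∑' k : ℤ, oddTerm z (13 * k + r.val)

lemma neg_one_zpow_eq_exp (n : ℤ) : (-1 : ℂ) ^ n = cexp (π * I * n) := by
  rw [mul_comm, Complex.exp_int_mul, exp_pi_mul_I]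

lemma oddTerm_eq_jacobiTheta₂_term (z : ℂ) (n : ℤ) :
    oddTerm z n =
      cexp (169 * π * I * z / 52) * jacobiTheta₂_term n ((1 - z) / 2) (z / 13) := by
  rw [oddTerm, neg_one_zpow_eq_exp, jacobiTheta₂_term, ← Complex.exp_add, ← Complex.exp_add]
  ring_nf

lemma oddTerm_thirteen_sub (z : ℂ) (n : ℤ) : oddTerm z (13 - n) = -oddTerm z n := by
  have h : (-1 : ℂ) ^ (13 - n) = -(-1) ^ n := by
    rw [show 13 - n = n + (2 * (6 - n) + 1) by ring, zpow_add₀ (by norm_num),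
      zpow_add₀ (by norm_num), zpow_mul]
    simp
  rw [oddTerm, oddTerm, h, neg_mul]
  push_cast
  ring_nf

lemma summable_oddTerm {z : ℂ} (hz : 0 < z.im) : Summable (oddTerm z) := by
  simp only [funext (oddTerm_eq_jacobiTheta₂_term z)]
  refine .mul_left _ <| (summable_jacobiTheta₂_term_iff _ _).mpr ?_
  simpa using hz

lemma residueTheta_intCast (z : ℂ) (n : ℤ) :
    residueTheta z n = ∑' k : ℤ, oddTerm z (13 * k + n) := by
  rw [residueTheta,
    ← (Equiv.addRight (n / 13)).tsum_eq fun k : ℤ ↦ oddTerm z (13 * k + (n : ZMod 13).val)]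
  refine tsum_congr fun k ↦ congrArg _ ?_
  rw [ZMod.val_intCast, Equiv.coe_addRight]
  push_cast
  omega

lemma residueTheta_odd (z : ℂ) : (residueTheta z).Odd := fun r ↦ by
  obtain ⟨n, rfl⟩ := ZMod.intCast_surjective r
  have : -(n : ZMod 13) = ((13 - n : ℤ) : ZMod 13) := by
    push_cast
    rw [show (13 : ZMod 13) = 0 from rfl, zero_sub]
  rw [this, residueTheta_intCast, residueTheta_intCast, ← tsum_neg, ← (Equiv.neg ℤ).tsum_eq]
  refine tsum_congr fun k ↦ ?_
  rw [← oddTerm_thirteen_sub, Equiv.neg_apply]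
  ring_nf

/-- Division with remainder by `13` as an equivalence. -/
def residueEquiv : ZMod 13 × ℤ ≃ ℤ where
  toFun p := 13 * p.2 + p.1.val
  invFun n := (n, n / 13)
  left_inv p := by
    have h := p.1.val_lt
    refine Prod.ext ?_ ?_
    · push_cast
      rw [show (13 : ZMod 13) = 0 from rfl, zero_mul, zero_add, ZMod.natCast_val, ZMod.cast_id]
    · dsimp only
      omega
  right_inv n := by
    dsimp only
    rw [ZMod.val_intCast]
    push_cast
    omega

lemma tsum_eq_sum_residue {f : ℤ → ℂ} (hf : Summable f) :
    ∑' n, f n = ∑ s : ZMod 13, ∑' k : ℤ, f (13 * k + s.val) := by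
  have h : Summable fun p ↦ f (residueEquiv p) := residueEquiv.summable_iff.mpr hf
  rw [← residueEquiv.tsum_eq, h.tsum_prod, tsum_fintype]
  rfl

lemma dft_residueTheta_intCast {z : ℂ} (hz : 0 < z.im) (n : ℤ) :
    𝓕 (residueTheta z) n = ∑' m : ℤ, chi ((-(m * n) : ℤ)) * oddTerm z m := by
  have hs : Summable fun m : ℤ ↦ chi ((-(m * n) : ℤ)) * oddTerm z m :=
    .of_norm <| by simpa using (summable_oddTerm hz).norm
  rw [tsum_eq_sum_residue hs, ZMod.dft_apply]
  refine Finset.sum_congr rfl fun s _ ↦ ?_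
  rw [residueTheta, smul_eq_mul, ← tsum_mul_left]
  refine tsum_congr fun k ↦ ?_
  congr 2
  push_cast
  rw [show (13 : ZMod 13) = 0 from rfl, zero_mul, zero_add, ZMod.natCast_val, ZMod.cast_id]

lemma residueTheta_add_one (z : ℂ) :
    residueTheta (z + 1) = cexp (2 * π * I * (13 / 8)) • twist 1 (residueTheta z) := by
  ext r
  obtain ⟨n, rfl⟩ := ZMod.intCast_surjective r
  rw [Pi.smul_apply, twist, smul_eq_mul, residueTheta_intCast, residueTheta_intCast,
    ← tsum_mul_left, ← tsum_mul_left]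
  refine tsum_congr fun k ↦ ?_
  have h : chi (7 * 1 * (n : ZMod 13) ^ 2) = chi ((7 * (13 * k + n) ^ 2 : ℤ) : ZMod 13) := by
    congr 1
    push_cast
    rw [show (13 : ZMod 13) = 0 from rfl]
    ring
  rw [h, ZMod.stdAddChar_coe]
  generalize 13 * k + n = m
  obtain ⟨a, ha⟩ : ∃ a : ℤ, m ^ 2 + m = 2 * a := by
    obtain ⟨a, ha⟩ := Int.even_mul_succ_self m
    exact ⟨a, by linarith⟩
  have ha' : (m : ℂ) ^ 2 + m = 2 * a := mod_cast ha
  rw [oddTerm, oddTerm, mul_left_comm _ ((-1) ^ m), mul_left_comm _ ((-1) ^ m), ← Complex.exp_add,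
    ← Complex.exp_add]
  congr 1
  refine Complex.exp_eq_exp_iff_exists_int.mpr ⟨-a, ?_⟩
  push_cast
  linear_combination (-2 * π * I / 2) * ha'

lemma residueTheta_eq_thetaSum (z : ℂ) (r : ℤ) :
    residueTheta z r = (-1) ^ r * (qp ((2 * r - 13) ^ 2 / 104) z * thetaSum (2 * r - 13) z) := by
  rw [residueTheta_intCast, thetaSum, ← tsum_mul_left, ← tsum_mul_left]
  refine tsum_congr fun k ↦ ?_
  have h : (-1 : ℂ) ^ (13 * k + r) = (-1) ^ r * (-1) ^ k := by
    rw [zpow_add₀ (by norm_num), zpow_mul, mul_comm]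
    norm_num
  rw [oddTerm, h, qp, qp, mul_left_comm (cexp _), ← Complex.exp_add, mul_assoc]
  congr 3
  push_cast
  ring

lemma thetaSum_neg (c : ℤ) (z : ℂ) : thetaSum (-c) z = thetaSum c z := by
  rw [thetaSum, thetaSum, ← (Equiv.neg ℤ).tsum_eq]
  refine tsum_congr fun k ↦ ?_
  rw [Equiv.neg_apply, show (-1 : ℂ) ^ (-k) = (-1) ^ k by
    rw [zpow_neg, ← inv_zpow]; norm_num]
  congr 2
  push_cast
  ring

lemma Avec_eq_coords (z : ℂ) : Avec z = coords (residueTheta z) := by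
  have h (r : ℤ) (s : ZMod 13) (hs : (r : ZMod 13) = s) :=
    hs ▸ residueTheta_eq_thetaSum z r
  have hn (c : ℤ) := thetaSum_neg c z
  rw [coords, h 12 12 rfl, h 10 10 rfl, h 4 4 rfl, h 5 5 rfl, h 2 2 rfl, h 6 6 rfl]
  norm_num [hn]
  ext i
  fin_cases i <;> simp [Avec, thc]

lemma residueTheta_neg_inv {z : ℂ} (hz : 0 < z.im) :
    residueTheta (-1 / z) = (-I / (13 * I / z) ^ (1 / 2 : ℂ)) • 𝓕 (residueTheta z) := by
  have hz0 : z ≠ 0 := fun h ↦ by simp [h] at hz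
  ext r
  obtain ⟨n, rfl⟩ := ZMod.intCast_surjective r
  have h2 : thetaSum (2 * n - 13) (-1 / z) =
      jacobiTheta₂ (1 / 2 - (2 * n - 13) / (2 * z)) (-13 / z) := by
    rw [thetaSum, jacobiTheta₂]
    refine tsum_congr fun k ↦ ?_
    rw [jacobiTheta₂_term, neg_one_zpow_eq_exp, qp, ← Complex.exp_add]
    push_cast
    ring_nf
  rw [residueTheta_eq_thetaSum, h2, jacobiTheta₂_functional_equation, Pi.smul_apply, smul_eq_mul,
    dft_residueTheta_intCast hz, show -I * (-13 / z) = 13 * I / z by ring]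
  generalize (13 * I / z) ^ (1 / 2 : ℂ) = P
  rw [qp, jacobiTheta₂, ← (Equiv.subLeft (7 : ℤ)).tsum_eq, ← tsum_mul_left, ← tsum_mul_left,
    ← tsum_mul_left, ← tsum_mul_left]
  refine tsum_congr fun m ↦ ?_
  have h3 : -I = cexp (-(π / 2 * I)) := by
    rw [Complex.exp_neg, Complex.exp_pi_div_two_mul_I, Complex.inv_I]
  rw [ZMod.stdAddChar_coe, oddTerm, jacobiTheta₂_term, Equiv.subLeft_apply, neg_one_zpow_eq_exp,
    neg_one_zpow_eq_exp, h3]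
  have h4 : ∀ a b c d e f g h : ℂ, (∃ k : ℤ, a + b + c + d = (e + f + g + h) + k * (2 * π * I)) →
      cexp a * (cexp b * (1 / P * cexp c * cexp d)) =
        cexp e / P * (cexp f * (cexp g * cexp h)) := by
    intro a b c d e f g h hk
    have := Complex.exp_eq_exp_iff_exists_int.mpr hk
    simp only [Complex.exp_add] at this
    linear_combination 1 / P * this
  refine h4 _ _ _ _ _ _ _ _ ⟨n - 3, ?_⟩
  push_cast
  field_simp
  ring

lemma etaF_eq_eta (z : ℂ) : etaF z = ModularForm.eta z := by
  rw [etaF, ModularForm.eta, Function.Periodic.qParam, qp]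
  simp only [← ModularForm.eta_q_eq_pow]
  congr 2
  push_cast
  ring

lemma eta_add_one_pow (z : ℂ) : ModularForm.eta (z + 1) ^ 6 = I * ModularForm.eta z ^ 6 := by
  have h : cexp (2 * π * I * (z + 1)) = cexp (2 * π * I * z) := by
    rw [mul_add, mul_one, Complex.exp_add, Complex.exp_two_pi_mul_I, mul_one]
  have h2 : Complex.exp (2 * π * I * (z + 1) / 24) ^ 6 = I * cexp (2 * π * I * z / 24) ^ 6 := by
    have hI : I = cexp (π / 2 * I) := Complex.exp_pi_div_two_mul_I.symm
    nth_rewrite 2 [hI]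
    rw [← Complex.exp_nat_mul, ← Complex.exp_nat_mul, ← Complex.exp_add]
    push_cast
    ring_nf
  simp only [ModularForm.eta, Function.Periodic.qParam, ModularForm.eta_q_eq_pow, mul_pow, h]
  push_cast
  rw [h2, mul_assoc]

lemma eta_neg_inv_pow {z : ℂ} (hz : 0 < z.im) :
    ModularForm.eta (-1 / z) ^ 6 = I * z ^ 3 * ModularForm.eta z ^ 6 := by
  have hsq (w : ℂ) (hw : w ≠ 0) : Complex.sqrt w ^ 6 = w ^ 3 := by
    rw [_root_.sqrt_eq_exp hw, ← Complex.exp_nat_mul]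
    push_cast
    rw [show 6 * (Complex.log w / 2) = (3 : ℕ) * Complex.log w by push_cast; ring,
      Complex.exp_nat_mul, Complex.exp_log hw]
  have hz0 : z ≠ 0 := fun h ↦ by simp [h] at hz
  have h := ModularForm.eta_comp_eq_csqrt_I_inv hz
  simp only [Function.comp_apply, Pi.smul_apply, Pi.mul_apply, smul_eq_mul] at h
  rw [h, mul_pow, mul_pow, inv_pow, hsq _ I_ne_zero, hsq _ hz0, I_pow_three]
  simp [mul_assoc]

lemma Phi18_Avec_add_one (z : ℂ) : Phi18 (Avec (z + 1)) = I * Phi18 (Avec z) := by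
  rw [Avec_eq_coords, Avec_eq_coords, residueTheta_add_one, coords_smul, Phi18_smul,
    Phi18_coords_twist_one, ← Complex.exp_nat_mul]
  congr 1
  refine Eq.trans ?_ Complex.exp_pi_div_two_mul_I
  exact Complex.exp_eq_exp_iff_exists_int.mpr ⟨29, by push_cast; ring⟩

lemma Phi18_Avec_neg_inv {z : ℂ} (hz : 0 < z.im) :
    Phi18 (Avec (-1 / z)) = I * z ^ 9 * Phi18 (Avec z) := by
  have hz0 : z ≠ 0 := fun h ↦ by simp [h] at hz
  have hP : ((13 * I / z) ^ (1 / 2 : ℂ)) ^ 18 = (13 * I / z) ^ 9 := by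
    rw [← Complex.cpow_nat_mul, ← Complex.cpow_natCast]
    norm_num
  rw [Avec_eq_coords, Avec_eq_coords, residueTheta_neg_inv hz, coords_smul, Phi18_smul,
    Phi18_coords_dft (residueTheta_odd z), div_pow, hP]
  have h1 : (-I) ^ 18 = -1 := by
    rw [Even.neg_pow (by decide), show 18 = 2 * 9 by rfl, pow_mul]
    norm_num
  have h2 : I ^ 9 = I := by rw [show 9 = 4 * 2 + 1 by rfl, pow_succ, pow_mul]; norm_num
  rw [h1, div_pow, mul_pow, h2]
  field_simp
  simp

/-- The weight `6` modular function `Φ₁₈(a₁, …, a₆) / η⁶`. -/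
def thetaQuotient (τ : ℍ) : ℂ := Phi18 (Avec τ) / ModularForm.eta τ ^ 6

open ModularForm in
lemma thetaQuotient_slash_T : thetaQuotient ∣[(6 : ℤ)] ModularGroup.T = thetaQuotient := by
  ext τ
  rw [SL_slash_apply, UpperHalfPlane.modular_T_smul]
  have : UpperHalfPlane.denom (ModularGroup.T : Matrix.SpecialLinearGroup (Fin 2) ℤ) τ = 1 := by
    rw [ModularGroup.denom_apply]
    simp [ModularGroup.T]
  have h : ((1 : ℝ) +ᵥ τ : ℍ) = ((τ : ℂ) + 1) := by
    rw [UpperHalfPlane.coe_vadd]; push_cast; ring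
  rw [this, thetaQuotient, thetaQuotient, h, Phi18_Avec_add_one, eta_add_one_pow]
  simp [mul_div_mul_left]

open ModularForm in
lemma thetaQuotient_slash_S : thetaQuotient ∣[(6 : ℤ)] ModularGroup.S = thetaQuotient := by
  ext τ
  have h0 := τ.ne_zero
  rw [SL_slash_apply, UpperHalfPlane.modular_S_smul]
  have : UpperHalfPlane.denom (ModularGroup.S : Matrix.SpecialLinearGroup (Fin 2) ℤ) τ = τ :=
    ModularGroup.denom_S τ
  rw [this, thetaQuotient, thetaQuotient, UpperHalfPlane.coe_mk,
    show (-(τ : ℂ))⁻¹ = -1 / τ by field_simp, Phi18_Avec_neg_inv τ.im_pos, eta_neg_inv_pow τ.im_pos]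
  have := eta_ne_zero τ.im_pos
  simp only [zpow_neg]
  norm_cast
  field_simp

/-- A vector scaled according to the leading exponents of the theta constants of order `13`. -/
def leadVec (t : ℂ) (u : Fin 6 → ℂ) : Fin 6 → ℂ :=
  ![t ^ 121 * u 0, t ^ 49 * u 1, t ^ 25 * u 2, t ^ 9 * u 3, t ^ 81 * u 4, t * u 5]

/-- The normalised cubic form `t ^ (-91) * Dinf (leadVec t u)`. -/
def leadDinf (u : Fin 6 → ℂ) : ℂ := u 3 * u 4 * u 5

/-- The leading exponent of the cubic form `D j` on `leadVec`. -/
def leadDExp (j : ℕ) : ℕ := if j < 2 then 195 - 96 * j else 8 * j - 13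

/-- The cubic form `D j (leadVec t u)` divided by `t ^ leadDExp j`, with `q = t ^ 104`. -/
def leadD : ℕ → ℂ → (Fin 6 → ℂ) → ℂ
  | 0, _, u => u 0 * u 1 * u 2
  | 1, q, u => 2 * u 1 * u 2 ^ 2 + u 1 ^ 2 * u 5 - u 3 ^ 2 * u 4 + u 0 * u 4 * u 5 * q
  | 2, q, u => -u 5 ^ 3 + u 1 ^ 2 * u 3 * q - 2 * u 1 * u 4 ^ 2 * q ^ 2
      + u 0 * u 3 * u 4 * q ^ 2 + 3 * u 2 * u 4 * u 5 * q
  | 3, q, u => 2 * u 0 * u 1 ^ 2 * q ^ 2 + u 0 ^ 2 * u 4 * q ^ 3 - u 3 * u 5 ^ 2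
      + u 2 * u 3 * u 4 * q
  | 4, q, u => -u 1 ^ 2 * u 2 * q + u 0 * u 5 ^ 2 * q - 2 * u 3 ^ 2 * u 5
      - u 0 * u 2 * u 4 * q ^ 2
  | 5, q, u => -u 3 ^ 3 + u 2 ^ 2 * u 4 * q - 2 * u 2 * u 5 ^ 2 + u 1 * u 4 * u 5 * q
      + 3 * u 0 * u 3 * u 5 * q
  | 6, q, u => -u 4 ^ 3 * q ^ 2 + u 0 ^ 2 * u 5 * q ^ 2 - 2 * u 0 * u 3 ^ 2 * q
      + u 2 * u 3 * u 5 + 3 * u 1 * u 3 * u 4 * q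
  | 7, q, u => -u 1 ^ 3 * q + u 2 * u 3 ^ 2 - u 0 * u 2 * u 5 * q - 3 * u 0 * u 1 * u 4 * q ^ 2
      + 2 * u 0 ^ 2 * u 3 * q ^ 2
  | 8, q, u => -u 0 ^ 3 * q ^ 3 + u 1 * u 5 ^ 2 - u 1 * u 2 * u 4 * q - 3 * u 0 * u 2 * u 3 * q
      + 2 * u 2 ^ 2 * u 5
  | 9, q, u => 2 * u 0 ^ 2 * u 2 * q ^ 2 + u 2 ^ 2 * u 3 - u 4 ^ 2 * u 5 * q + u 1 * u 3 * u 5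
  | 10, q, u => -u 0 * u 2 ^ 2 * q + u 1 * u 3 ^ 2 - 2 * u 3 * u 4 ^ 2 * q - u 0 * u 1 * u 5 * q
  | 11, q, u => -u 2 ^ 3 + u 0 * u 4 ^ 2 * q ^ 2 - u 0 * u 1 * u 3 * q - 3 * u 1 * u 2 * u 5
      + 2 * u 1 ^ 2 * u 4 * q
  | 12, q, u => -u 0 ^ 2 * u 1 * q ^ 2 + u 2 * u 4 ^ 2 * q - 2 * u 4 * u 5 ^ 2 - u 1 * u 2 * u 3
  | _, _, _ => 0

/-- The leading exponent of the sextic form `Gs j` on `leadVec`. -/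
def leadGExp (j : ℕ) : ℕ := if j < 4 then 8 * j + 78 else 8 * j - 26

/-- The sextic form `Gs j (leadVec t u)` divided by `t ^ leadGExp j`, with `q = t ^ 104`. -/
def leadG : ℕ → ℂ → (Fin 6 → ℂ) → ℂ
  | 0, q, u => leadD 0 q u ^ 2 * q ^ 3 + leadDinf u ^ 2 * q
  | 1, q, u => -leadD 7 q u ^ 2 + 2 * leadD 0 q u * leadD 1 q u * q ^ 2
      + 10 * leadDinf u * leadD 1 q u * q + 2 * leadD 2 q u * leadD 12 q u
      - 2 * leadD 3 q u * leadD 11 q u - 4 * leadD 4 q u * leadD 10 q u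
      - 2 * leadD 9 q u * leadD 5 q u
  | 2, q, u => -2 * leadD 1 q u ^ 2 * q - 4 * leadD 0 q u * leadD 2 q u * q
      + 6 * leadDinf u * leadD 2 q u - 2 * leadD 4 q u * leadD 11 q u
      + 2 * leadD 5 q u * leadD 10 q u - 2 * leadD 6 q u * leadD 9 q u
      - 2 * leadD 7 q u * leadD 8 q u
  | 3, q, u => -leadD 8 q u ^ 2 + 2 * leadD 0 q u * leadD 3 q u * q
      + 10 * leadDinf u * leadD 3 q u + 2 * leadD 6 q u * leadD 10 q u
      - 2 * leadD 9 q u * leadD 7 q u - 4 * leadD 12 q u * leadD 4 q u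
      - 2 * leadD 1 q u * leadD 2 q u
  | 4, q, u => -leadD 2 q u ^ 2 + 10 * leadD 0 q u * leadD 4 q u * q ^ 2
      - 2 * leadDinf u * leadD 4 q u * q + 2 * leadD 5 q u * leadD 12 q u * q
      - 2 * leadD 9 q u * leadD 8 q u * q - 4 * leadD 1 q u * leadD 3 q u * q
      - 2 * leadD 10 q u * leadD 7 q u * q
  | 5, q, u => -2 * leadD 9 q u ^ 2 * q - 4 * leadD 0 q u * leadD 5 q u * q ^ 2
      + 6 * leadDinf u * leadD 5 q u * q - 2 * leadD 10 q u * leadD 8 q u * q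
      + 2 * leadD 6 q u * leadD 12 q u * q - 2 * leadD 2 q u * leadD 3 q u
      - 2 * leadD 11 q u * leadD 7 q u * q
  | 6, q, u => -2 * leadD 3 q u ^ 2 - 4 * leadD 0 q u * leadD 6 q u * q ^ 2
      + 6 * leadDinf u * leadD 6 q u * q - 2 * leadD 12 q u * leadD 7 q u * q
      + 2 * leadD 2 q u * leadD 4 q u - 2 * leadD 5 q u * leadD 1 q u * q
      - 2 * leadD 8 q u * leadD 11 q u * q
  | 7, q, u => -2 * leadD 10 q u ^ 2 * q + 6 * leadD 0 q u * leadD 7 q u * q ^ 2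
      + 4 * leadDinf u * leadD 7 q u * q - 2 * leadD 1 q u * leadD 6 q u * q
      - 2 * leadD 2 q u * leadD 5 q u - 2 * leadD 8 q u * leadD 12 q u * q
      - 2 * leadD 9 q u * leadD 11 q u * q
  | 8, q, u => -2 * leadD 4 q u ^ 2 + 6 * leadD 0 q u * leadD 8 q u * q ^ 2
      + 4 * leadDinf u * leadD 8 q u * q - 2 * leadD 3 q u * leadD 5 q u
      - 2 * leadD 6 q u * leadD 2 q u - 2 * leadD 11 q u * leadD 10 q u * q
      - 2 * leadD 1 q u * leadD 7 q u * q
  | 9, q, u => -leadD 11 q u ^ 2 * q + 2 * leadD 0 q u * leadD 9 q u * q ^ 2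
      + 10 * leadDinf u * leadD 9 q u * q + 2 * leadD 5 q u * leadD 4 q u
      - 2 * leadD 1 q u * leadD 8 q u * q - 4 * leadD 10 q u * leadD 12 q u * q
      - 2 * leadD 3 q u * leadD 6 q u
  | 10, q, u => -leadD 5 q u ^ 2 + 10 * leadD 0 q u * leadD 10 q u * q ^ 2
      - 2 * leadDinf u * leadD 10 q u * q + 2 * leadD 6 q u * leadD 4 q u
      - 2 * leadD 3 q u * leadD 7 q u - 4 * leadD 9 q u * leadD 1 q u * q
      - 2 * leadD 12 q u * leadD 11 q u * q
  | 11, q, u => -2 * leadD 12 q u ^ 2 * q + 6 * leadD 0 q u * leadD 11 q u * q ^ 2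
      + 4 * leadDinf u * leadD 11 q u * q - 2 * leadD 9 q u * leadD 2 q u
      - 2 * leadD 5 q u * leadD 6 q u - 2 * leadD 7 q u * leadD 4 q u
      - 2 * leadD 3 q u * leadD 8 q u
  | 12, q, u => -leadD 6 q u ^ 2 + 10 * leadD 0 q u * leadD 12 q u * q ^ 2
      - 2 * leadDinf u * leadD 12 q u * q + 2 * leadD 2 q u * leadD 10 q u
      - 2 * leadD 1 q u * leadD 11 q u * q - 4 * leadD 3 q u * leadD 9 q u
      - 2 * leadD 4 q u * leadD 8 q u
  | _, _, _ => 0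

lemma Dinf_leadVec (t : ℂ) (u : Fin 6 → ℂ) : Dinf (leadVec t u) = t ^ 91 * leadDinf u := by
  simp only [Dinf, leadVec, leadDinf, Matrix.cons_val]
  ring

lemma D_leadVec (t : ℂ) (u : Fin 6 → ℂ) (j : ℕ) :
    D j (leadVec t u) = t ^ leadDExp j * leadD j (t ^ 104) u := by
  match j with
  | 0 | 1 | 2 | 3 | 4 | 5 | 6 | 7 | 8 | 9 | 10 | 11 | 12 =>
    simp only [D, leadVec, leadD, leadDExp, Matrix.cons_val, Nat.reduceLT, if_true, if_false,
      Nat.reduceMul, Nat.reduceSub]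
    ring
  | n + 13 => simp [D, leadD]

lemma Gs_leadVec (t : ℂ) (u : Fin 6 → ℂ) (j : ℕ) :
    Gs j (leadVec t u) = t ^ leadGExp j * leadG j (t ^ 104) u := by
  match j with
  | 0 | 1 | 2 | 3 | 4 | 5 | 6 | 7 | 8 | 9 | 10 | 11 | 12 =>
    simp only [Gs, D_leadVec, Dinf_leadVec, leadG, leadGExp, leadDExp, Nat.reduceLT, if_true,
      if_false, Nat.reduceMul, Nat.reduceSub, Nat.reduceAdd]
    ring
  | n + 13 => simp [Gs, leadG]

lemma continuous_leadD (j : ℕ) : Continuous fun p : ℂ × (Fin 6 → ℂ) ↦ leadD j p.1 p.2 := by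
  match j with
  | 0 | 1 | 2 | 3 | 4 | 5 | 6 | 7 | 8 | 9 | 10 | 11 | 12 =>
    simp only [leadD]
    fun_prop
  | n + 13 => simpa only [leadD] using continuous_const

lemma continuous_leadG (j : ℕ) : Continuous fun p : ℂ × (Fin 6 → ℂ) ↦ leadG j p.1 p.2 := by
  have hD := continuous_leadD
  have hI : Continuous fun p : ℂ × (Fin 6 → ℂ) ↦ leadDinf p.2 := by
    simp only [leadDinf]
    fun_prop
  match j with
  | 0 | 1 | 2 | 3 | 4 | 5 | 6 | 7 | 8 | 9 | 10 | 11 | 12 =>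
    simp only [leadG]
    fun_prop
  | n + 13 => simpa only [leadG] using continuous_const

lemma sum_pow_three_sum_chi (c : ZMod 13 → ℂ) :
    ∑ ν : ZMod 13, (∑ j, chi (ν * j) * c j) ^ 3 = 13 * ∑ j, ∑ k, c j * c k * c (-(j + k)) := by
  have h (j k l : ZMod 13) : ∑ ν, chi (ν * j) * c j * (chi (ν * k) * c k) * (chi (ν * l) * c l) =
      if l = -(j + k) then 13 * (c j * c k * c l) else 0 := by
    have : ∑ ν : ZMod 13, chi (ν * (j + k + l)) = if l = -(j + k) then 13 else 0 := by
      simp only [eq_neg_iff_add_eq_zero, add_comm l]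
      simpa using AddChar.sum_mulShift (j + k + l) (ZMod.isPrimitive_stdAddChar 13)
    rw [← zero_mul (c j * c k * c l), ← ite_mul, ← this, Finset.sum_mul]
    refine Finset.sum_congr rfl fun ν _ ↦ ?_
    rw [mul_add, mul_add, AddChar.map_add_eq_mul, AddChar.map_add_eq_mul]
    ring
  have e (a : ZMod 13 → ℂ) : (∑ j, a j) ^ 3 = ∑ j, ∑ k, ∑ l, a j * a k * a l := by
    rw [pow_three', Finset.sum_mul_sum]
    simp only [Finset.sum_mul]
    simp only [Finset.mul_sum]
  simp only [e]
  rw [Finset.sum_comm, Finset.mul_sum]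
  refine Finset.sum_congr rfl fun j _ ↦ ?_
  rw [Finset.sum_comm, Finset.mul_sum]
  refine Finset.sum_congr rfl fun k _ ↦ ?_
  rw [Finset.sum_comm]
  simp only [h, Finset.sum_ite_eq', Finset.mem_univ, if_true]

lemma deltaF_val_eq_sum (ν : ZMod 13) (v : Fin 6 → ℂ) :
    deltaF ν.val v = ∑ j, chi (ν * j) * ((if j = 0 then -13 else 1) * Gs j.val v) := by
  have h (j : ZMod 13) : chi (ν * j) = chi ν ^ j.val := by
    rw [← AddChar.map_nsmul_eq_pow, nsmul_eq_mul, ZMod.natCast_val, ZMod.cast_id, mul_comm]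
  simp only [deltaF, zeta13_pow_val, h]
  rw [← Finset.add_sum_erase _ _ (Finset.mem_univ (0 : ZMod 13))]
  congr 1
  · simp
  · refine Finset.sum_bij' (fun j _ ↦ (j : ZMod 13)) (fun j _ ↦ j.val) ?_ ?_ ?_ ?_ ?_
    · decide
    · decide
    · decide
    · decide
    · intro j hj
      obtain ⟨h1, h2⟩ := Finset.mem_Icc.mp hj
      have hv : (j : ZMod 13).val = j := ZMod.val_cast_of_lt (by lia)
      have h0 : (j : ZMod 13) ≠ 0 := fun h ↦ by
        rw [h, ZMod.val_zero] at hv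
        lia
      rw [hv, if_neg h0, one_mul]

/-- The coefficient of the leading power of `t` in the `j`-th component of `deltaF`. -/
def leadCoeff (j : ZMod 13) (q : ℂ) (u : Fin 6 → ℂ) : ℂ :=
  (if j = 0 then -13 else 1) * leadG j.val q u

/-- The form `Φ₁₈ (leadVec t u)` divided by `t ^ 26`. -/
def leadPhi (t : ℂ) (u : Fin 6 → ℂ) : ℂ :=
  1 / (13 * 6) * (13 * (∑ j : ZMod 13, ∑ k : ZMod 13,
    t ^ (leadGExp j.val + leadGExp k.val + leadGExp (-(j + k)).val - 26) *
      (leadCoeff j (t ^ 104) u * leadCoeff k (t ^ 104) u * leadCoeff (-(j + k)) (t ^ 104) u)) +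
    t ^ 208 * (13 ^ 2 * leadG 0 (t ^ 104) u) ^ 3)

lemma Phi18_leadVec (t : ℂ) (u : Fin 6 → ℂ) :
    Phi18 (leadVec t u) = t ^ 26 * leadPhi t u := by
  have h26 : ∀ j k : ZMod 13,
      26 ≤ leadGExp j.val + leadGExp k.val + leadGExp (-(j + k)).val := by decide
  have hG (j : ZMod 13) : (if j = 0 then -13 else 1) * Gs j.val (leadVec t u) =
      t ^ leadGExp j.val * leadCoeff j (t ^ 104) u := by
    rw [Gs_leadVec, leadCoeff, mul_left_comm]
  have key (j k : ZMod 13) : t ^ leadGExp j.val * leadCoeff j (t ^ 104) u *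
      (t ^ leadGExp k.val * leadCoeff k (t ^ 104) u) *
      (t ^ leadGExp (-(j + k)).val * leadCoeff (-(j + k)) (t ^ 104) u) =
      t ^ 26 * (t ^ (leadGExp j.val + leadGExp k.val + leadGExp (-(j + k)).val - 26) *
      (leadCoeff j (t ^ 104) u * leadCoeff k (t ^ 104) u * leadCoeff (-(j + k)) (t ^ 104) u)) := by
    rw [← mul_assoc (t ^ 26), ← pow_add, Nat.add_sub_of_le (h26 j k), pow_add, pow_add]
    ring
  rw [Phi18_eq_sum_zmod, leadPhi]
  simp only [deltaF_val_eq_sum, sum_pow_three_sum_chi, hG, key, ← Finset.mul_sum]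
  rw [deltaInf, Gs_leadVec, leadGExp, if_pos (by norm_num)]
  ring

lemma continuous_leadPhi : Continuous fun p : ℂ × (Fin 6 → ℂ) ↦ leadPhi p.1 p.2 := by
  have hG (j : ℕ) : Continuous fun p : ℂ × (Fin 6 → ℂ) ↦ leadG j (p.1 ^ 104) p.2 :=
    (continuous_leadG j).comp (f := fun p : ℂ × (Fin 6 → ℂ) ↦ (p.1 ^ 104, p.2)) (by fun_prop)
  have hC (j : ZMod 13) : Continuous fun p : ℂ × (Fin 6 → ℂ) ↦ leadCoeff j (p.1 ^ 104) p.2 :=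
    continuous_const.mul (hG _)
  have hG0 := hG 0
  simp only [leadPhi]
  fun_prop

lemma leadPhi_zero : leadPhi 0 ![1, 1, 1, -1, 1, 1] = 1 := by
  have h4 : leadCoeff 4 0 ![1, 1, 1, -1, 1, 1] = -1 := by
    rw [leadCoeff, if_neg (by decide), one_mul]
    change leadG 4 _ _ = _
    simp [leadG, leadD]
  have h5 : leadCoeff 5 0 ![1, 1, 1, -1, 1, 1] = 2 := by
    rw [leadCoeff, if_neg (by decide), one_mul]
    change leadG 5 _ _ = _
    simp [leadG, leadD]
  have h : ∀ j k : ZMod 13, leadGExp j.val + leadGExp k.val + leadGExp (-(j + k)).val - 26 = 0 ↔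
      (j, k) ∈ ({(4, 4), (4, 5), (5, 4)} : Finset (ZMod 13 × ZMod 13)) := by decide
  have e1 : -(4 + 4 : ZMod 13) = 5 := rfl
  have e2 : -(4 + 5 : ZMod 13) = 4 := rfl
  have e3 : -(5 + 4 : ZMod 13) = 4 := rfl
  have e4 : (4 : ZMod 13) ≠ 5 := by decide
  rw [leadPhi]
  simp only [zero_pow_eq, h, ite_mul, zero_mul, one_mul, OfNat.ofNat_ne_zero, if_false, add_zero]
  rw [← Fintype.sum_prod_type', Finset.sum_ite_mem, Finset.univ_inter,
    Finset.sum_insert (by simp [e4]), Finset.sum_pair (by simp [e4])]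
  simp only [e1, e2, e3, h4, h5]
  norm_num

open UpperHalfPlane hiding I
open Filter Topology
open scoped MatrixGroups Manifold

lemma thetaSum_term_eq (c n : ℤ) (z : ℂ) :
    (-1 : ℂ) ^ n * qp ((13 * (n : ℚ) ^ 2 + (c : ℚ) * (n : ℚ)) / 2) z =
      jacobiTheta₂_term n (1 / 2 + c * z / 2) (13 * z) := by
  rw [jacobiTheta₂_term, neg_one_zpow_eq_exp, qp, ← Complex.exp_add]
  push_cast
  ring_nf

lemma norm_qp (α : ℚ) (z : ℂ) : ‖qp α z‖ = Real.exp (-(2 * π * z.im * α)) := by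
  rw [qp, Complex.norm_exp,
    show 2 * (π : ℂ) * I * α * z = ((2 * π * α : ℝ) : ℂ) * (I * z) by push_cast; ring,
    Complex.re_ofReal_mul, Complex.I_mul_re]
  ring_nf

lemma differentiableAt_qp (α : ℚ) (z : ℂ) : DifferentiableAt ℂ (qp α) z := by
  unfold qp
  fun_prop

lemma differentiableAt_thetaSum (c : ℤ) {z : ℂ} (hz : 0 < z.im) :
    DifferentiableAt ℂ (thetaSum c) z := by
  have h : thetaSum c = (fun p : ℂ × ℂ ↦ jacobiTheta₂ p.1 p.2) ∘
      fun z ↦ (1 / 2 + c * z / 2, 13 * z) := by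
    ext z
    simp only [thetaSum, thetaSum_term_eq, Function.comp_apply, jacobiTheta₂]
  rw [h]
  have h13 : 0 < (13 * z).im := by simpa using hz
  exact (hasFDerivAt_jacobiTheta₂ (1 / 2 + c * z / 2) h13).differentiableAt.comp z (by fun_prop)

lemma tendsto_thetaSum {c : ℤ} (hc : |c| < 13) :
    Tendsto (fun τ : ℍ ↦ thetaSum c τ) atImInfty (𝓝 1) := by
  have hpos (n : ℤ) : 0 ≤ 13 * n ^ 2 + c * n := by
    obtain ⟨h1, h2⟩ := abs_lt.mp hc
    rcases lt_trichotomy n 0 with hn | rfl | hn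
    · nlinarith
    · simp
    · nlinarith
  have hpos' {n : ℤ} (hn : n ≠ 0) : 0 < 13 * n ^ 2 + c * n := by
    obtain ⟨h1, h2⟩ := abs_lt.mp hc
    rcases lt_or_gt_of_ne hn with hn | hn <;> nlinarith
  have key : Tendsto (fun τ : ℍ ↦ ∑' n : ℤ,
      (-1 : ℂ) ^ n * qp ((13 * (n : ℚ) ^ 2 + (c : ℚ) * (n : ℚ)) / 2) τ) atImInfty
      (𝓝 (∑' n : ℤ, if n = 0 then 1 else 0)) := tendsto_tsum_of_dominated_convergence
    (bound := fun n ↦ ‖(-1 : ℂ) ^ n * qp ((13 * (n : ℚ) ^ 2 + (c : ℚ) * (n : ℚ)) / 2) I‖)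
    ?_ ?_ ?_
  · simpa only [tsum_ite_eq, thetaSum, Rat.cast_intCast] using key
  · simp only [thetaSum_term_eq]
    exact ((summable_jacobiTheta₂_term_iff _ _).mpr (by simp)).norm
  · intro n
    split_ifs with hn
    · simp [hn, qp]
    · rw [tendsto_zero_iff_norm_tendsto_zero]
      simp only [norm_mul, norm_zpow, norm_neg, norm_one, one_zpow, one_mul, norm_qp]
      refine Real.tendsto_exp_neg_atTop_nhds_zero.comp ?_
      have : (0 : ℝ) < 13 * (n : ℝ) ^ 2 + c * n := mod_cast hpos' hn
      push_cast
      exact (tendsto_comap.const_mul_atTop (by positivity)).atTop_mul_const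
        (by positivity)
  · filter_upwards [tendsto_comap.eventually (eventually_ge_atTop (1 : ℝ))] with τ hτ n
    have : (0 : ℝ) ≤ 13 * (n : ℝ) ^ 2 + c * n := mod_cast hpos n
    simp only [norm_mul, norm_zpow, norm_neg, norm_one, one_zpow, one_mul, norm_qp]
    push_cast
    rw [Complex.I_im]
    gcongr
    exact hτ

lemma differentiableAt_Avec {z : ℂ} (hz : 0 < z.im) (i : Fin 6) :
    DifferentiableAt ℂ (fun z ↦ Avec z i) z := by
  have h1 := fun α ↦ differentiableAt_qp α z
  have h2 := fun c ↦ differentiableAt_thetaSum c hz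
  fin_cases i
  all_goals
    simp only [Avec, thc]
    fun_prop

lemma differentiable_Gs (j : ℕ) : Differentiable ℂ fun v ↦ Gs j v := by
  have hD (j : ℕ) : Differentiable ℂ fun v ↦ D j v := by
    match j with
    | 0 | 1 | 2 | 3 | 4 | 5 | 6 | 7 | 8 | 9 | 10 | 11 | 12 =>
      simp only [D]
      fun_prop
    | n + 13 => simpa only [D] using differentiable_const _
  have hI : Differentiable ℂ fun v ↦ Dinf v := by
    unfold Dinf
    fun_prop
  match j with
  | 0 | 1 | 2 | 3 | 4 | 5 | 6 | 7 | 8 | 9 | 10 | 11 | 12 =>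
    simp only [Gs]
    fun_prop
  | n + 13 => simpa only [Gs] using differentiable_const _

lemma differentiable_Phi18 : Differentiable ℂ Phi18 := by
  have h := differentiable_Gs
  unfold Phi18 deltaF deltaInf
  fun_prop

open ModularForm in
lemma mdifferentiable_thetaQuotient : MDiff thetaQuotient := by
  rw [UpperHalfPlane.mdifferentiable_iff]
  refine .congr (f := fun z ↦ Phi18 (Avec z) / ModularForm.eta z ^ 6)
    (fun z hz ↦ (DifferentiableAt.div ?_ ?_ ?_).differentiableWithinAt) fun z hz ↦ ?_
  · exact differentiable_Phi18.differentiableAt.comp z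
      (differentiableAt_pi.mpr fun i ↦ differentiableAt_Avec hz i)
  · exact (differentiableAt_eta_of_mem_upperHalfPlaneSet hz).pow 6
  · exact pow_ne_zero 6 (eta_ne_zero hz)
  · simp [thetaQuotient, ofComplex_apply_of_im_pos hz]

/-- The theta series of order `13`, normalised to have constant term `±1`. -/
def thetaUnits (z : ℂ) : Fin 6 → ℂ :=
  ![thetaSum 11 z, thetaSum 7 z, thetaSum 5 z, -thetaSum 3 z, thetaSum 9 z, thetaSum 1 z]

lemma qp_pow (α : ℚ) (z : ℂ) (n : ℕ) : qp α z ^ n = qp (n * α) z := by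
  rw [qp, qp, ← Complex.exp_nat_mul]
  push_cast
  ring_nf

lemma Avec_eq_leadVec (z : ℂ) : Avec z = leadVec (qp (1 / 104) z) (thetaUnits z) := by
  ext i
  fin_cases i <;> simp [Avec, thc, leadVec, thetaUnits, qp_pow, div_eq_mul_inv]

lemma tendsto_qp {α : ℚ} (hα : 0 < α) :
    Tendsto (fun τ : ℍ ↦ qp α τ) atImInfty (𝓝 0) := by
  rw [tendsto_zero_iff_norm_tendsto_zero]
  simp only [norm_qp]
  have : (0 : ℝ) < α := mod_cast hα
  exact Real.tendsto_exp_neg_atTop_nhds_zero.comp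
    ((tendsto_comap.const_mul_atTop (by positivity)).atTop_mul_const this)

lemma tendsto_thetaUnits :
    Tendsto (fun τ : ℍ ↦ thetaUnits τ) atImInfty (𝓝 ![1, 1, 1, -1, 1, 1]) := by
  have h := fun (c : ℤ) (hc : |c| < 13) ↦ tendsto_thetaSum hc
  rw [tendsto_pi_nhds]
  intro i
  fin_cases i
  · exact h 11 (by norm_num)
  · exact h 7 (by norm_num)
  · exact h 5 (by norm_num)
  · exact (h 3 (by norm_num)).neg
  · exact h 9 (by norm_num)
  · exact h 1 (by norm_num)

open ModularForm in
lemma tendsto_tprod_one_sub_eta_q :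
    Tendsto (fun τ : ℍ ↦ ∏' n : ℕ, (1 - eta_q n τ)) atImInfty (𝓝 1) := by
  have hcont : ContinuousAt (fun q : ℂ ↦ ∏' n : ℕ, (1 - q ^ (n + 1))) 0 :=
    (multipliableLocallyUniformlyOn_one_sub_pow.hasProdLocallyUniformlyOn.differentiableOn
      (.of_forall fun _ ↦ by simpa [Finset.prod_fn] using
        DifferentiableOn.finsetProd (fun _ _ ↦ by fun_prop)) Metric.isOpen_ball).differentiableAt
      (Metric.ball_mem_nhds 0 one_pos) |>.continuousAt
  have h := hcont.tendsto.comp (qParam_tendsto_atImInfty one_pos)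
  simpa [Function.comp_def, eta_q] using h

open ModularForm in
lemma tendsto_thetaQuotient : Tendsto thetaQuotient atImInfty (𝓝 1) := by
  have h1 : Tendsto (fun τ : ℍ ↦ leadPhi (qp (1 / 104) τ) (thetaUnits τ)) atImInfty (𝓝 1) := by
    have h := (continuous_leadPhi.tendsto (0, ![1, 1, 1, -1, 1, 1])).comp
      ((tendsto_qp (α := 1 / 104) (by norm_num)).prodMk_nhds tendsto_thetaUnits)
    rw [leadPhi_zero] at h
    exact h
  have h2 := h1.div (tendsto_tprod_one_sub_eta_q.pow 6) (by simp)
  rw [one_pow, div_one] at h2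
  refine h2.congr fun τ ↦ ?_
  have hq : qp (1 / 24) τ ^ 6 = qp (1 / 104) τ ^ 26 := by
    rw [qp_pow, qp_pow]
    norm_num
  have hη : ModularForm.eta τ = qp (1 / 24) τ * ∏' n : ℕ, (1 - eta_q n τ) := by
    rw [ModularForm.eta, qp, Function.Periodic.qParam]
    push_cast
    ring_nf
  have h0 : qp (1 / 104) τ ≠ 0 := Complex.exp_ne_zero _
  simp only [Pi.div_apply, thetaQuotient, Avec_eq_leadVec, Phi18_leadVec, hη, mul_pow, hq]
  exact (mul_div_mul_left _ _ (pow_ne_zero _ h0)).symm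

/-- `thetaQuotient` as a modular form of weight `6` and level one. -/
def thetaQuotientForm : ModularForm 𝒮ℒ 6 where
  toFun := thetaQuotient
  slash_action_eq' A hA := by
    obtain ⟨A, rfl⟩ := hA
    exact SlashInvariantForm.slash_action_generators_SL2Z thetaQuotient_slash_S thetaQuotient_slash_T A
  holo' := mdifferentiable_thetaQuotient
  bdd_at_cusps' hc := by
    rw [Subgroup.IsArithmetic.isCusp_iff_isCusp_SL2Z] at hc
    rw [OnePoint.isBoundedAt_iff_forall_SL2Z hc]
    intro γ _
    rw [SlashInvariantForm.slash_action_generators_SL2Z thetaQuotient_slash_S thetaQuotient_slash_T]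
    exact tendsto_thetaQuotient.isBigO_one ℝ

lemma thetaQuotientForm_apply (τ : ℍ) : thetaQuotientForm τ = thetaQuotient τ := rfl

open ModularForm in
lemma thetaQuotientForm_eq_E₆ : thetaQuotientForm = E₆ := by
  have h0 : (qExpansion 1 thetaQuotientForm).coeff 0 = 1 := by
    rw [qExpansion_coeff_zero one_pos
      (ModularFormClass.analyticAt_cuspFunction_zero _ one_pos one_mem_strictPeriods_SL)
      (SlashInvariantFormClass.periodic_comp_ofComplex _ one_mem_strictPeriods_SL)]
    exact tendsto_thetaQuotient.limUnder_eq
  have hcusp : IsCuspForm (thetaQuotientForm - E₆) := by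
    rw [isCuspForm_iff_coeffZero_eq_zero, FunLike.coe_sub,
      ModularForm.qExpansion_sub one_pos one_mem_strictPeriods_SL, map_sub, h0,
      EisensteinSeries.E_qExpansion_coeff_zero _ ⟨3, rfl⟩, sub_self]
  obtain ⟨g, hg⟩ := hcusp
  have hg0 : g = 0 := rank_zero_iff_forall_zero.mp
    (CuspForm.rank_eq_zero_of_weight_lt_twelve (by norm_num)) g
  rw [hg0, map_zero] at hg
  exact (sub_eq_zero.mp hg.symm)

lemma E6_eq_E₆ (τ : ℍ) : E6 τ = ModularForm.E₆ τ := by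
  have h : ModularForm.E₆ τ =
      (1 / 2 : ℂ) * ∑' v : EisensteinSeries.gammaSet 1 1 0, EisensteinSeries.eisSummand 6 v τ := rfl
  let e : {p : ℤ × ℤ // Int.gcd p.1 p.2 = 1} ≃ EisensteinSeries.gammaSet 1 1 0 :=
    (finTwoArrowEquiv ℤ).symm.subtypeEquiv fun p ↦ by
      rw [EisensteinSeries.gammaSet_one_mem_iff]
      rfl
  rw [h, E6, ← e.tsum_eq]
  rfl

lemma X_eq_smul (z : ℂ) : X z = etaF z • Avec z := rfl

end

/-- `Φ18(x1(z),…,x6(z)) = Δ(z)·E6(z)` on ℍ. -/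
theorem stmt_15 (z : ℂ) (hz : 0 < z.im) : Phi18 (X z) = Delta z * E6 z := by
  have h := DFunLike.congr_fun thetaQuotientForm_eq_E₆ (⟨z, hz⟩ : UpperHalfPlane)
  rw [thetaQuotientForm_apply, ← E6_eq_E₆, thetaQuotient, UpperHalfPlane.coe_mk] at h
  have h0 := ModularForm.eta_ne_zero hz
  rw [← h, X_eq_smul, Phi18_smul, Delta, etaF_eq_eta]
  field_simp

end
end

section
/- For every z in the upper half-plane ℍ: Φ20(x1(z),…,x6(z)) = η(z)^8·Δ(z)·E4(z). -/
open Complex Finset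

noncomputable section

local notation "ζ" => zeta13

namespace Order13

instance fact_prime_thirteen : Fact (Nat.Prime 13) := ⟨by norm_num⟩

/-- The quadratic character modulo 13, with complex values. -/
def chi : MulChar (ZMod 13) ℂ := (quadraticChar (ZMod 13)).ringHomComp (Int.castRingHom ℂ)

/-- The quadratic Gauss sum modulo 13. -/
def gauss : ℂ := gaussSum chi ZMod.stdAddChar

lemma chi_apply (x : ZMod 13) : chi x = (quadraticChar (ZMod 13) x : ℂ) := rfl

lemma chi_ne_one : chi ≠ 1 := by
  intro h
  have h2 : chi 2 = (1 : MulChar (ZMod 13) ℂ) 2 := by rw [h]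
  rw [chi_apply, MulChar.one_apply (by decide), show quadraticChar (ZMod 13) 2 = -1 by decide] at h2
  norm_num at h2

lemma chi_isQuadratic : chi.IsQuadratic := (quadraticChar_isQuadratic (ZMod 13)).comp _

lemma gauss_sq : gauss ^ 2 = 13 := by
  rw [gauss, gaussSum_sq chi_ne_one chi_isQuadratic (ZMod.isPrimitive_stdAddChar 13),
    chi_apply, show quadraticChar (ZMod 13) (-1) = 1 by decide]
  simp

lemma chi_sq {x : ZMod 13} (hx : x ≠ 0) : chi x ^ 2 = 1 := by
  rw [chi_apply]
  exact_mod_cast quadraticChar_sq_one hx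

lemma chi_five : chi 5 = -1 := by
  rw [chi_apply, show quadraticChar (ZMod 13) 5 = -1 by decide]
  simp

lemma chi_neg (x : ZMod 13) : chi (-x) = chi x := by
  rw [chi_apply, chi_apply, show quadraticChar (ZMod 13) (-x) = quadraticChar (ZMod 13) x by
    revert x; decide]

lemma sum_chi_mul_stdAddChar (a : ZMod 13) :
    ∑ x, chi x * ZMod.stdAddChar (5 * (x * a)) = -(gauss * chi a) := by
  rcases eq_or_ne a 0 with rfl | ha
  · rw [MulChar.map_zero]
    simp [MulChar.sum_eq_zero_of_ne_one chi_ne_one]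
  · have h := gaussSum_mulShift_eq chi ZMod.stdAddChar
      (Units.mk0 (5 * a) (mul_ne_zero (by decide) ha))
    rw [chi_isQuadratic.inv, Units.val_mk0, map_mul, chi_five] at h
    simp only [gaussSum, AddChar.mulShift_apply] at h
    rw [show gauss = ∑ x, chi x * ZMod.stdAddChar x from rfl]
    linear_combination (norm := skip) h
    rw [sub_eq_zero_of_eq]
    simp only [mul_left_comm, mul_comm, mul_assoc]
    ring_nf

/-- The sum of `F` against `chi` and the character with parameter `ν` of the hyperbolic form. -/
def lineSum (ν : ZMod 13) (F : ZMod 13 → ZMod 13 → ℂ) : ℂ :=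
  ∑ u, ∑ v, chi u * ZMod.stdAddChar (5 * (ν * u * v)) * F u v

/-- The analogue of `lineSum` for the parameter `∞`, up to a Gauss sum. -/
def lineSumInf (F : ZMod 13 → ZMod 13 → ℂ) : ℂ := ∑ v, chi v * F 0 v

/-- The Fourier transform with respect to the hyperbolic form. -/
def hypFourier (F : ZMod 13 → ZMod 13 → ℂ) (u v : ZMod 13) : ℂ :=
  ∑ u', ∑ v', ZMod.stdAddChar (5 * (u * v' + v * u')) * F u' v'

lemma sum_stdAddChar_mul (b : ZMod 13) :
    ∑ v, ZMod.stdAddChar (5 * (v * b)) = if b = 0 then (13 : ℂ) else 0 := by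
  have h := AddChar.sum_mulShift (5 * b) (ZMod.isPrimitive_stdAddChar 13)
  have h5 : (5 : ZMod 13) ≠ 0 := by decide
  simpa [mul_left_comm, h5] using h

lemma lineSum_hypFourier (ν : ZMod 13) (F : ZMod 13 → ZMod 13 → ℂ) :
    lineSum ν (hypFourier F) = ∑ u', ∑ v', (∑ u, if ν * u + u' = 0 then
      13 * (chi u * ZMod.stdAddChar (5 * (u * v'))) else 0) * F u' v' := by
  have h (u u' v' : ZMod 13) : (if ν * u + u' = 0 then
      13 * (chi u * ZMod.stdAddChar (5 * (u * v'))) else 0) =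
      ∑ v, chi u * ZMod.stdAddChar (5 * (ν * u * v)) *
        ZMod.stdAddChar (5 * (u * v' + v * u')) := by
    have : ∀ v, chi u * ZMod.stdAddChar (5 * (ν * u * v)) *
        ZMod.stdAddChar (5 * (u * v' + v * u')) =
        chi u * ZMod.stdAddChar (5 * (u * v')) * ZMod.stdAddChar (5 * (v * (ν * u + u'))) := by
      intro v
      rw [mul_assoc (chi u), mul_assoc (chi u), ← AddChar.map_add_eq_mul, ← AddChar.map_add_eq_mul]
      congr 2
      ring
    simp_rw [this, ← mul_sum, sum_stdAddChar_mul]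
    split_ifs <;> ring
  simp_rw [h, lineSum, hypFourier, mul_sum, sum_mul]
  calc _ = ∑ u, ∑ u', ∑ v', ∑ v, chi u * ZMod.stdAddChar (5 * (ν * u * v)) *
        ZMod.stdAddChar (5 * (u * v' + v * u')) * F u' v' := by
        refine sum_congr rfl fun u _ ↦ ?_
        rw [sum_comm]
        refine sum_congr rfl fun u' _ ↦ ?_
        rw [sum_comm]
        simp only [mul_assoc]
    _ = _ := by
        rw [sum_comm]
        refine sum_congr rfl fun u' _ ↦ ?_
        rw [sum_comm]

lemma lineSum_hypFourier_of_ne_zero {ν : ZMod 13} (hν : ν ≠ 0) (F : ZMod 13 → ZMod 13 → ℂ) :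
    lineSum ν (hypFourier F) = 13 * chi ν * lineSum (-ν⁻¹) F := by
  have h (u u' : ZMod 13) : ν * u + u' = 0 ↔ u = -ν⁻¹ * u' := by
    constructor
    · intro h
      field_simp
      linear_combination h
    · rintro rfl
      field_simp
      ring
  have hinv : chi ν⁻¹ = chi ν := by
    rw [← MulChar.inv_apply', chi_isQuadratic.inv]
  simp_rw [lineSum_hypFourier, h, lineSum, mul_sum, sum_ite_eq', mem_univ, if_true, map_mul,
    chi_neg, hinv, mul_assoc]

lemma lineSum_hypFourier_zero (F : ZMod 13 → ZMod 13 → ℂ) :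
    lineSum 0 (hypFourier F) = -(13 * gauss * lineSumInf F) := by
  rw [lineSum_hypFourier, sum_eq_single 0]
  · simp_rw [zero_mul, add_zero, if_true, ← mul_sum, sum_chi_mul_stdAddChar, lineSumInf, mul_sum,
      ← sum_neg_distrib]
    exact sum_congr rfl fun _ _ ↦ by ring
  · intro u _ hu
    simp [hu]
  · simp

lemma lineSumInf_hypFourier (F : ZMod 13 → ZMod 13 → ℂ) :
    lineSumInf (hypFourier F) = -(gauss * lineSum 0 F) := by
  simp_rw [lineSumInf, lineSum, hypFourier, mul_sum]
  rw [sum_comm]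
  simp_rw [← sum_neg_distrib]
  refine sum_congr rfl fun u _ ↦ ?_
  rw [sum_comm]
  refine sum_congr rfl fun v _ ↦ ?_
  simp_rw [← mul_assoc, ← sum_mul, zero_mul, zero_add, sum_chi_mul_stdAddChar]
  simp

lemma sum_lineSum_hypFourier_pow_ten (F : ZMod 13 → ZMod 13 → ℂ) :
    ∑ ν, lineSum ν (hypFourier F) ^ 10 + (gauss * lineSumInf (hypFourier F)) ^ 10 =
      13 ^ 10 * (∑ ν, lineSum ν F ^ 10 + (gauss * lineSumInf F) ^ 10) := by
  have h (ν : ZMod 13) (hν : ν ∈ univ.erase 0) :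
      lineSum ν (hypFourier F) ^ 10 = 13 ^ 10 * lineSum (-ν⁻¹) F ^ 10 := by
    rw [lineSum_hypFourier_of_ne_zero (ne_of_mem_erase hν), mul_pow, mul_pow,
      show 10 = 2 * 5 from rfl, pow_mul (chi ν), chi_sq (ne_of_mem_erase hν), one_pow, mul_one]
  have h2 : ∑ ν ∈ univ.erase (0 : ZMod 13), lineSum (-ν⁻¹) F ^ 10 =
      ∑ ν ∈ univ.erase 0, lineSum ν F ^ 10 :=
    sum_nbij' (fun ν ↦ -ν⁻¹) (fun ν ↦ -ν⁻¹) (by simp) (by simp) (by simp [inv_neg])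
      (by simp [inv_neg]) (by simp)
  have hg : gauss ^ 10 = 13 ^ 5 := by rw [show 10 = 2 * 5 from rfl, pow_mul, gauss_sq]
  have hg' : gauss ^ 20 = 13 ^ 10 := by rw [show 20 = 2 * 10 from rfl, pow_mul, gauss_sq]
  rw [← add_sum_erase _ _ (mem_univ 0), sum_congr rfl h, ← mul_sum, h2, lineSum_hypFourier_zero,
    lineSumInf_hypFourier, ← add_sum_erase univ (fun ν ↦ lineSum ν F ^ 10) (mem_univ 0)]
  linear_combination lineSum 0 F ^ 10 * hg'

/-- The odd function on `ZMod 13` whose values are, up to sign, the coordinates of `v`. -/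
def oddExt (v : Fin 6 → ℂ) (x : ZMod 13) : ℂ :=
  (![0, v 5, v 0, v 3, -v 4, v 2, v 1, -v 1, -v 2, v 4, -v 3, -v 0, -v 5] : Fin 13 → ℂ) x

/-- The product of two values of `f`, in coordinates diagonalizing the form `u * v`. -/
def hypProd (f : ZMod 13 → ℂ) (u v : ZMod 13) : ℂ := f (7 * (u + v)) * f (4 * (u - v))

lemma chi_values : chi 0 = 0 ∧ chi 1 = 1 ∧ chi 2 = -1 ∧ chi 3 = 1 ∧ chi 4 = 1 ∧ chi 5 = -1 ∧
    chi 6 = -1 ∧ chi 7 = -1 ∧ chi 8 = -1 ∧ chi 9 = 1 ∧ chi 10 = 1 ∧ chi 11 = -1 ∧ chi 12 = 1 := by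
  have h (x : ZMod 13) (n : ℤ) (hx : quadraticChar (ZMod 13) x = n) : chi x = n := by
    rw [chi_apply, hx]
  refine ⟨?_, ?_, ?_, ?_, ?_, ?_, ?_, ?_, ?_, ?_, ?_, ?_, ?_⟩
  all_goals first
    | exact_mod_cast h _ 0 (by decide)
    | exact_mod_cast h _ 1 (by decide)
    | exact_mod_cast h _ (-1) (by decide)

lemma oddExt_values (v : Fin 6 → ℂ) : oddExt v 0 = 0 ∧ oddExt v 1 = v 5 ∧ oddExt v 2 = v 0 ∧
    oddExt v 3 = v 3 ∧ oddExt v 4 = -v 4 ∧ oddExt v 5 = v 2 ∧ oddExt v 6 = v 1 ∧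
    oddExt v 7 = -v 1 ∧ oddExt v 8 = -v 2 ∧ oddExt v 9 = v 4 ∧ oddExt v 10 = -v 3 ∧
    oddExt v 11 = -v 0 ∧ oddExt v 12 = -v 5 :=
  ⟨rfl, rfl, rfl, rfl, rfl, rfl, rfl, rfl, rfl, rfl, rfl, rfl, rfl⟩

lemma sum_zmod_thirteen (g : ZMod 13 → ℂ) : ∑ x, g x = g 0 + g 1 + g 2 + g 3 + g 4 + g 5 + g 6 +
    g 7 + g 8 + g 9 + g 10 + g 11 + g 12 :=
  (Fin.sum_univ_castSucc (n := 12) g).trans (by simp only [Fin.sum_univ_castSucc]; simp; rfl)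

lemma lineSum_hypProd (v : Fin 6 → ℂ) (ν : ZMod 13) :
    lineSum ν (hypProd (oddExt v)) = 4 * (A 0 v + ZMod.stdAddChar (ν * 1) * A 1 v +
      ZMod.stdAddChar (ν * 4) * A 2 v + ZMod.stdAddChar (ν * 9) * A 3 v +
      ZMod.stdAddChar (ν * 3) * A 4 v + ZMod.stdAddChar (ν * 12) * A 5 v +
      ZMod.stdAddChar (ν * 10) * A 6 v) := by
  simp only [lineSum, hypProd, sum_zmod_thirteen, chi_values]
  reduce_mod_char
  simp only [oddExt_values, A, mul_zero, zero_mul, AddChar.map_zero_eq_one, one_mul, neg_mul,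
    add_zero, mul_neg, neg_neg, neg_zero, mul_one]
  ring_nf
  reduce_mod_char
  ring

lemma lineSumInf_hypProd (v : Fin 6 → ℂ) : lineSumInf (hypProd (oddExt v)) = -4 * A 0 v := by
  simp only [lineSumInf, hypProd, sum_zmod_thirteen, chi_values]
  reduce_mod_char
  simp only [oddExt_values, A]
  ring

lemma stdAddChar_natCast (n : ℕ) : ZMod.stdAddChar (n : ZMod 13) = ζ ^ n := by
  rw [ZMod.stdAddChar_apply, ← Int.cast_natCast, ZMod.toCircle_intCast, zeta13, ← Complex.exp_nat_mul]
  push_cast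
  ring_nf

lemma Phi20_eq (v : Fin 6 → ℂ) : Phi20 v = (1 / 325 / 4 ^ 10) *
    (∑ ν, lineSum ν (hypProd (oddExt v)) ^ 10 +
      (gauss * lineSumInf (hypProd (oddExt v))) ^ 10) := by
  have hw (ν : ℕ) : w ν v ^ 5 = 1 / 4 ^ 10 * lineSum (ν : ZMod 13) (hypProd (oddExt v)) ^ 10 := by
    have h (k : ℕ) : ZMod.stdAddChar ((ν : ZMod 13) * (k : ZMod 13)) = ζ ^ (k * ν) := by
      rw [← stdAddChar_natCast]; push_cast; rw [mul_comm]
    have h1 := h 1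
    have h2 := h 4
    have h3 := h 9
    have h4 := h 3
    have h5 := h 12
    have h6 := h 10
    push_cast at h1 h2 h3 h4 h5 h6
    rw [lineSum_hypProd, h1, h2, h3, h4, h5, h6, w, one_mul, mul_pow, ← pow_mul, ← mul_assoc,
      one_div_mul_cancel (by norm_num), one_mul]
  have hg : gauss ^ 10 = 13 ^ 5 := by rw [show 10 = 2 * 5 from rfl, pow_mul, gauss_sq]
  rw [Phi20, winf, lineSumInf_hypProd, mul_pow gauss, hg, sum_congr rfl fun ν _ ↦ hw ν, ← mul_sum,
    sum_zmod_thirteen]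
  simp only [sum_range_succ, sum_range_zero]
  push_cast
  ring

/-- The Fourier transform on `ZMod 13` with respect to the character `x ↦ e(-3x/13)`. -/
def fourier (f : ZMod 13 → ℂ) (x : ZMod 13) : ℂ := ∑ y, ZMod.stdAddChar (-3 * x * y) * f y

lemma hypProd_fourier (f : ZMod 13 → ℂ) : hypProd (fourier f) = hypFourier (hypProd f) := by
  ext u v
  simp_rw [hypProd, fourier, hypFourier, sum_mul_sum, ← sum_product']
  have h13 : (13 : ZMod 13) = 0 := rfl
  refine sum_nbij' (fun p ↦ (p.1 + 5 * p.2, p.1 - 5 * p.2))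
    (fun p ↦ (7 * (p.1 + p.2), 4 * (p.1 - p.2))) (by simp) (by simp) ?_ ?_ ?_
  · rintro ⟨r, s⟩ -
    ext
    · linear_combination r * h13
    · linear_combination 3 * s * h13
  · rintro ⟨r, s⟩ -
    ext
    · linear_combination (2 * r - s) * h13
    · linear_combination (2 * s - r) * h13
  · rintro ⟨r, s⟩ -
    have e1 : 7 * (r + 5 * s + (r - 5 * s)) = r := by linear_combination r * h13
    have e2 : 4 * (r + 5 * s - (r - 5 * s)) = s := by linear_combination 3 * s * h13
    have e3 : 5 * (u * (r - 5 * s) + v * (r + 5 * s)) =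
        -3 * (7 * (u + v)) * r + -3 * (4 * (u - v)) * s := by
      linear_combination (2 * r * (u + v) + s * (v - u)) * h13
    simp only [hypProd, e1, e2, e3, AddChar.map_add_eq_mul]
    ring

lemma Phi20_of_fourier {v v' : Fin 6 → ℂ} (c : ℂ)
    (h : ∀ x, oddExt v' x = c * fourier (oddExt v) x) :
    Phi20 v' = c ^ 20 * 13 ^ 10 * Phi20 v := by
  have hp : hypProd (oddExt v') = fun x y ↦ c ^ 2 * hypFourier (hypProd (oddExt v)) x y := by
    ext x y
    rw [← hypProd_fourier, hypProd, hypProd, h, h]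
    ring
  have hl (F : ZMod 13 → ZMod 13 → ℂ) (ν : ZMod 13) :
      lineSum ν (fun x y ↦ c ^ 2 * F x y) = c ^ 2 * lineSum ν F := by
    simp_rw [lineSum, mul_sum, mul_left_comm]
  have hi (F : ZMod 13 → ZMod 13 → ℂ) :
      lineSumInf (fun x y ↦ c ^ 2 * F x y) = c ^ 2 * lineSumInf F := by
    simp_rw [lineSumInf, mul_sum, mul_left_comm]
  rw [Phi20_eq, Phi20_eq, hp, hi]
  simp_rw [hl, mul_pow, ← mul_sum]
  have := sum_lineSum_hypFourier_pow_ten (hypProd (oddExt v))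
  simp_rw [mul_pow] at this
  linear_combination (1 / 325 / 4 ^ 10 * c ^ 20) * this

/-- The theta constant `∑ (-1) ^ n q ^ ((26 n + c) ^ 2 / 104)`. -/
def theta (c : ℤ) (z : ℂ) : ℂ :=
  ∑' n : ℤ, (-1) ^ n * cexp (2 * Real.pi * I * z * (26 * n + c) ^ 2 / 104)

lemma neg_one_zpow_eq_exp (n : ℤ) : (-1 : ℂ) ^ n = cexp (Real.pi * I * n) := by
  rw [← Complex.exp_pi_mul_I, ← Complex.exp_int_mul, mul_comm]

lemma qp_mul_thetaSum (c : ℤ) (α : ℚ) (hα : α = c ^ 2 / 104) (z : ℂ) :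
    qp α z * thetaSum c z = theta c z := by
  rw [thetaSum, ← tsum_mul_left, theta]
  refine tsum_congr fun n ↦ ?_
  rw [qp, qp, mul_left_comm, ← Complex.exp_add, hα]
  push_cast
  ring_nf

lemma theta_neg (c : ℤ) (z : ℂ) : theta (-c) z = theta c z := by
  rw [theta, ← (Equiv.neg ℤ).tsum_eq, theta]
  refine tsum_congr fun n ↦ ?_
  rw [Equiv.neg_apply, zpow_neg, ← inv_zpow, inv_neg_one]
  push_cast
  ring_nf

lemma theta_add_twentySix (c : ℤ) (z : ℂ) : theta (c + 26) z = -theta c z := by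
  rw [theta, ← (Equiv.subRight (1 : ℤ)).tsum_eq, theta, ← tsum_neg]
  refine tsum_congr fun n ↦ ?_
  rw [Equiv.subRight_apply, zpow_sub₀ (by norm_num)]
  push_cast
  ring_nf

lemma theta_add_mul (c k : ℤ) (z : ℂ) : theta (52 * k + c) z = theta c z := by
  induction k using Int.induction_on with
  | zero => simp
  | succ k ih =>
    rw [show 52 * ((k : ℤ) + 1) + c = 52 * k + c + 26 + 26 by ring, theta_add_twentySix,
      theta_add_twentySix, neg_neg, ih]
  | pred k ih =>
    rw [← ih, show 52 * (-(k : ℤ)) + c = 52 * (-(k : ℤ) - 1) + c + 26 + 26 by ring,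
      theta_add_twentySix, theta_add_twentySix, neg_neg]

lemma theta_sub (c : ℤ) (z : ℂ) : theta (26 - c) z = -theta c z := by
  rw [show 26 - c = -c + 26 by ring, theta_add_twentySix, theta_neg]

lemma theta_thirteen (z : ℂ) : theta 13 z = 0 := by
  have := theta_sub 13 z
  norm_num at this
  linear_combination this / 2

lemma Avec_eq (z : ℂ) : Avec z = ![theta 11 z, theta 7 z, theta 5 z, -theta 3 z, theta 9 z,
    theta 1 z] := by
  ext i
  fin_cases i <;> simp only [Avec, thc] <;>
    first
    | exact qp_mul_thetaSum _ _ (by norm_num) z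
    | exact congrArg _ (qp_mul_thetaSum _ _ (by norm_num) z)

lemma theta_eq_oddExt (m : ℤ) (hm : m % 4 = 1) (z : ℂ) : theta m z = oddExt (Avec z) m := by
  obtain ⟨r, k, hr0, hr, rfl⟩ : ∃ r k : ℤ, 0 ≤ r ∧ r < 13 ∧ m = 52 * k + (4 * r + 1) :=
    ⟨m / 4 % 13, m / 52, by lia, by lia, by lia⟩
  have h13 : ((52 * k + (4 * r + 1) : ℤ) : ZMod 13) = 4 * r + 1 := by
    push_cast
    reduce_mod_char
  rw [theta_add_mul, h13, Avec_eq]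
  have h1 := theta_sub 9 z
  have h2 := theta_sub 5 z
  have h3 := theta_sub 1 z
  have h4 := theta_add_twentySix 3 z
  have h5 := theta_add_twentySix 7 z
  have h6 := theta_add_twentySix 11 z
  have h7 := theta_sub (-15) z
  have h8 := theta_sub (-19) z
  have h9 := theta_sub (-23) z
  have h10 := theta_sub 11 z
  have h11 := theta_sub 7 z
  have h12 := theta_sub 3 z
  rw [theta_neg] at h7 h8 h9
  norm_num at h1 h2 h3 h4 h5 h6 h7 h8 h9 h10 h11 h12
  have := theta_thirteen z
  interval_cases r <;> norm_num <;> reduce_mod_char <;> simp only [oddExt_values] <;>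
    simp [*]

lemma tsum_int_eq_sum {n : ℕ} [NeZero n] {f : ℤ → ℂ} (hf : Summable f) :
    ∑' k, f k = ∑ j : Fin n, ∑' k : ℤ, f (k * n + (j : ℕ)) := by
  let e := ((Int.divModEquiv n).trans (Equiv.prodComm ℤ (Fin n))).symm
  have hs : Summable fun p ↦ f (e p) := e.summable_iff.2 hf
  rw [← e.tsum_eq, hs.tsum_prod, tsum_fintype]
  rfl

/-- The scalar factor in the transformation of the theta constants under `z ↦ -1 / z`. -/
def autFactor (z : ℂ) : ℂ := 1 / (-I * (-13 / z)) ^ (1 / 2 : ℂ)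

lemma theta_eq_jacobiTheta₂ (c : ℤ) (z : ℂ) : theta c z =
    cexp (2 * Real.pi * I * z * c ^ 2 / 104) * jacobiTheta₂ ((c * z + 1) / 2) (13 * z) := by
  rw [theta, jacobiTheta₂, ← tsum_mul_left]
  refine tsum_congr fun n ↦ ?_
  rw [jacobiTheta₂_term, neg_one_zpow_eq_exp, ← Complex.exp_add, ← Complex.exp_add]
  ring_nf

lemma theta_neg_inv_eq_tsum (c : ℤ) {z : ℂ} (hz : z ≠ 0) : theta c (-1 / z) = autFactor z *
    ∑' n : ℤ, cexp (Real.pi * I * z * (2 * n - 1) ^ 2 / 52 + Real.pi * I * c * (2 * n - 1) / 26) := by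
  rw [theta_eq_jacobiTheta₂, jacobiTheta₂_functional_equation, jacobiTheta₂,
    mul_assoc (1 / _), mul_left_comm, autFactor, show 13 * (-1 / z) = -13 / z by ring]
  congr 1
  rw [← mul_assoc, ← Complex.exp_add, ← tsum_mul_left]
  refine tsum_congr fun n ↦ ?_
  rw [jacobiTheta₂_term, ← Complex.exp_add]
  congr 1
  field_simp
  ring

lemma theta_neg_inv {c : ℤ} (hc : c % 4 = 1) {z : ℂ} (hz : 0 < z.im) :
    theta c (-1 / z) = autFactor z * ∑ j : Fin 13,
      cexp (Real.pi * I * c * (2 * (j : ℕ) - 1) / 26) * theta (2 * (j : ℕ) - 1) z := by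
  have hz0 : z ≠ 0 := by rintro rfl; simp at hz
  have hs : Summable fun n : ℤ ↦
      cexp (Real.pi * I * z * (2 * n - 1) ^ 2 / 52 + Real.pi * I * c * (2 * n - 1) / 26) := by
    have : 0 < (z / 13).im := by
      rw [show (13 : ℂ) = ((13 : ℝ) : ℂ) by norm_num, Complex.div_ofReal_im]
      positivity
    refine (((summable_jacobiTheta₂_term_iff (-(z - c) / 26) (z / 13)).2 this).mul_left
      (cexp (Real.pi * I * (z - 2 * c) / 52))).congr fun n ↦ ?_
    rw [jacobiTheta₂_term, ← Complex.exp_add]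
    ring_nf
  rw [theta_neg_inv_eq_tsum c hz0, tsum_int_eq_sum (n := 13) hs]
  congr 1
  refine sum_congr rfl fun j _ ↦ ?_
  rw [theta, ← tsum_mul_left]
  refine tsum_congr fun k ↦ ?_
  obtain ⟨d, rfl⟩ : ∃ d, c = 2 * d + 1 := ⟨c / 2, by lia⟩
  rw [neg_one_zpow_eq_exp, ← Complex.exp_add, ← Complex.exp_add, Complex.exp_eq_exp_iff_exists_int]
  refine ⟨d * k, ?_⟩
  push_cast
  ring

lemma exp_mul_theta {c m : ℤ} (hc : c % 4 = 1) (hm : m % 2 = 1) (z : ℂ) :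
    cexp (Real.pi * I * c * m / 26) * theta m z =
      I * (ZMod.stdAddChar (-3 * c * m : ZMod 13) * oddExt (Avec z) m) := by
  have key {m : ℤ} (hm : m % 4 = 1) : cexp (Real.pi * I * c * m / 26) * theta m z =
      I * (ZMod.stdAddChar (-3 * c * m : ZMod 13) * oddExt (Avec z) m) := by
    have he : ZMod.stdAddChar (-3 * c * m : ZMod 13) =
        cexp (2 * Real.pi * I * (-3 * c * m) / 13) := by
      rw [ZMod.stdAddChar_apply, show (-3 * c * m : ZMod 13) = ((-3 * c * m : ℤ) : ZMod 13) by
        push_cast; ring, ZMod.toCircle_intCast]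
      push_cast
      ring_nf
    rw [theta_eq_oddExt m hm, he, ← mul_assoc]
    congr 1
    nth_rewrite 2 [← Complex.exp_pi_div_two_mul_I]
    rw [← Complex.exp_add, Complex.exp_eq_exp_iff_exists_int]
    obtain ⟨d, hd⟩ : ∃ d, c * m = 4 * d + 1 :=
      ⟨c * m / 4, by have := Int.mul_emod c m 4; rw [hc, hm] at this; lia⟩
    have hd' : (c * m : ℂ) = 4 * d + 1 := by exact_mod_cast hd
    refine ⟨d, ?_⟩
    linear_combination (Real.pi * I / 2) * hd'
  rcases (by lia : m % 4 = 1 ∨ (m + 26) % 4 = 1) with h | h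
  · exact key h
  · have h2 := key h
    rw [theta_add_twentySix] at h2
    have h13 : ((m + 26 : ℤ) : ZMod 13) = m := by push_cast; reduce_mod_char
    rw [h13] at h2
    rw [← h2, mul_neg, ← neg_mul]
    congr 1
    rw [← neg_one_mul, ← Complex.exp_pi_mul_I, ← Complex.exp_add, Complex.exp_eq_exp_iff_exists_int]
    obtain ⟨d, rfl⟩ : ∃ d, c = 2 * d + 1 := ⟨c / 2, by lia⟩
    refine ⟨-(d + 1), ?_⟩
    push_cast
    ring

lemma oddExt_Avec_neg_inv {z : ℂ} (hz : 0 < z.im) (x : ZMod 13) :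
    oddExt (Avec (-1 / z)) x = autFactor z * I * fourier (oddExt (Avec z)) x := by
  obtain ⟨c, hc, rfl⟩ : ∃ c : ℤ, c % 4 = 1 ∧ x = c := by
    refine ⟨40 * x.val + 13, by lia, ?_⟩
    push_cast
    rw [ZMod.natCast_zmod_val]
    reduce_mod_char
  rw [← theta_eq_oddExt c hc, theta_neg_inv hc hz, fourier, mul_assoc (autFactor z)]
  congr 1
  rw [sum_zmod_thirteen]
  have h (j : Fin 13) := exp_mul_theta (m := 2 * (j : ℕ) - 1) hc (by lia) z
  push_cast at h
  simp_rw [h]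
  simp only [Fin.sum_univ_castSucc]
  simp
  ring_nf
  reduce_mod_char
  rw [AddChar.map_zero_eq_one]
  ring_nf
  reduce_mod_char
  ring

lemma Phi20_Avec_neg_inv {z : ℂ} (hz : 0 < z.im) :
    Phi20 (Avec (-1 / z)) = -z ^ 10 * Phi20 (Avec z) := by
  have hz0 : z ≠ 0 := by rintro rfl; simp at hz
  rw [Phi20_of_fourier _ (oddExt_Avec_neg_inv hz), mul_pow]
  have h : autFactor z ^ 2 = z / (13 * I) := by
    rw [autFactor, div_pow, one_pow, show (1 / 2 : ℂ) = ((2 : ℕ) : ℂ)⁻¹ by norm_num,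
      Complex.cpow_nat_inv_pow _ (by norm_num)]
    field_simp
  rw [show 20 = 2 * 10 from rfl, pow_mul, h, pow_mul, I_sq, div_pow, mul_pow,
    show (I : ℂ) ^ 10 = (I ^ 2) ^ 5 by ring, I_sq]
  field_simp

/-- The scalar factor in the transformation of the theta constants under `z ↦ z + 1`. -/
def transFactor : ℂ := cexp (2 * Real.pi * I * (5 / 8))

lemma transFactor_sq : transFactor ^ 2 = I := by
  rw [transFactor, ← Complex.exp_nat_mul]
  nth_rewrite 2 [← Complex.exp_pi_div_two_mul_I]
  rw [Complex.exp_eq_exp_iff_exists_int]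
  exact ⟨1, by push_cast; ring⟩

lemma theta_add_one {c : ℤ} (hc : c % 2 = 1) (z : ℂ) :
    theta c (z + 1) = cexp (2 * Real.pi * I * c ^ 2 / 104) * theta c z := by
  rw [theta, theta, ← tsum_mul_left]
  refine tsum_congr fun n ↦ ?_
  rw [mul_left_comm, ← Complex.exp_add]
  congr 1
  rw [Complex.exp_eq_exp_iff_exists_int]
  obtain ⟨d, hd⟩ : ∃ d, n * (13 * n + c) = 2 * d := by
    obtain h | h := Int.even_or_odd' n |>.choose_spec
    · exact ⟨_, by rw [h, mul_assoc]⟩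
    · refine ⟨n * ((13 * n + c) / 2), ?_⟩
      rw [mul_left_comm, Int.mul_ediv_cancel' (by lia)]
  refine ⟨d, ?_⟩
  have hd' : (n * (13 * n + c) : ℂ) = 2 * d := by exact_mod_cast hd
  linear_combination (Real.pi * I) * hd'

lemma oddExt_Avec_add_one (z : ℂ) (x : ZMod 13) : oddExt (Avec (z + 1)) x =
    transFactor * ZMod.stdAddChar (5 * x ^ 2) * oddExt (Avec z) x := by
  obtain ⟨c, hc, rfl⟩ : ∃ c : ℤ, c % 4 = 1 ∧ x = c := by
    refine ⟨40 * x.val + 13, by lia, ?_⟩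
    push_cast
    rw [ZMod.natCast_zmod_val]
    reduce_mod_char
  rw [← theta_eq_oddExt c hc, ← theta_eq_oddExt c hc, theta_add_one (by lia), transFactor,
    ZMod.stdAddChar_apply, show (5 * c ^ 2 : ZMod 13) = ((5 * c ^ 2 : ℤ) : ZMod 13) by push_cast; ring,
    ZMod.toCircle_intCast, ← Complex.exp_add]
  congr 1
  rw [Complex.exp_eq_exp_iff_exists_int]
  obtain ⟨d, rfl⟩ : ∃ d, c = 4 * d + 1 := ⟨c / 4, by lia⟩
  refine ⟨-(6 * d ^ 2 + 3 * d + 1), ?_⟩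
  push_cast
  ring

lemma Phi20_Avec_add_one (z : ℂ) : Phi20 (Avec (z + 1)) = -Phi20 (Avec z) := by
  have hp (u v : ZMod 13) : hypProd (oddExt (Avec (z + 1))) u v =
      I * (ZMod.stdAddChar (5 * (u * v)) * hypProd (oddExt (Avec z)) u v) := by
    have h : (5 * (u * v) : ZMod 13) = 5 * (7 * (u + v)) ^ 2 + 5 * (4 * (u - v)) ^ 2 := by
      ring_nf
      reduce_mod_char
    rw [hypProd, oddExt_Avec_add_one, oddExt_Avec_add_one, hypProd, h, AddChar.map_add_eq_mul,
      ← transFactor_sq]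
    ring
  have hl (ν : ZMod 13) : lineSum ν (hypProd (oddExt (Avec (z + 1)))) =
      I * lineSum (ν + 1) (hypProd (oddExt (Avec z))) := by
    simp_rw [lineSum, mul_sum, hp]
    refine sum_congr rfl fun u _ ↦ sum_congr rfl fun v _ ↦ ?_
    rw [show 5 * ((ν + 1) * u * v) = 5 * (ν * u * v) + 5 * (u * v) by ring,
      AddChar.map_add_eq_mul]
    ring
  have hi : lineSumInf (hypProd (oddExt (Avec (z + 1)))) =
      I * lineSumInf (hypProd (oddExt (Avec z))) := by
    simp_rw [lineSumInf, mul_sum, hp]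
    refine sum_congr rfl fun v _ ↦ ?_
    simp
    ring
  have h10 : (I : ℂ) ^ 10 = -1 := by rw [show 10 = 2 * 5 from rfl, pow_mul, I_sq]; norm_num
  have hs := Equiv.sum_comp (Equiv.addRight (1 : ZMod 13))
    (fun ν ↦ lineSum ν (hypProd (oddExt (Avec z))) ^ 10)
  rw [Equiv.coe_addRight] at hs
  rw [Phi20_eq, Phi20_eq, hi]
  simp_rw [hl, mul_pow, ← mul_sum, hs, h10]
  ring

lemma etaF_eq (z : ℂ) : etaF z = ModularForm.eta z := by
  rw [etaF, ModularForm.eta, qp, Function.Periodic.qParam]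
  congr 1
  · push_cast
    ring_nf
  · simp_rw [ModularForm.eta_q_eq_pow]

lemma etaF_add_one_pow (z : ℂ) : etaF (z + 1) ^ 12 = -etaF z ^ 12 := by
  have h : etaF (z + 1) = cexp (2 * Real.pi * I / 24) * etaF z := by
    have h1 : cexp (2 * Real.pi * I * (z + 1)) = cexp (2 * Real.pi * I * z) := by
      rw [mul_add, mul_one, Complex.exp_add, Complex.exp_two_pi_mul_I, mul_one]
    rw [etaF, etaF, h1, ← mul_assoc, qp, qp, ← Complex.exp_add]
    congr 2
    push_cast
    ring
  rw [h, mul_pow, ← Complex.exp_nat_mul, ← neg_one_mul, ← Complex.exp_pi_mul_I]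
  congr 2
  push_cast
  ring

lemma etaF_neg_inv_pow {z : ℂ} (hz : 0 < z.im) : etaF (-1 / z) ^ 12 = -z ^ 6 * etaF z ^ 12 := by
  have hz0 : z ≠ 0 := by rintro rfl; simp at hz
  have hs {w : ℂ} (hw : w ≠ 0) : sqrt w ^ 12 = w ^ 6 := by
    rw [sqrt_eq_exp hw, ← Complex.exp_nat_mul]
    nth_rewrite 2 [← Complex.exp_log hw]
    rw [← Complex.exp_nat_mul]
    congr 1
    push_cast
    ring
  have h := ModularForm.eta_comp_eq_csqrt_I_inv hz
  simp only [Function.comp_apply, Pi.smul_apply, Pi.mul_apply, smul_eq_mul] at h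
  rw [etaF_eq, etaF_eq, h, mul_pow, mul_pow, inv_pow, hs hz0, hs I_ne_zero,
    show (I : ℂ) ^ 6 = (I ^ 2) ^ 3 by ring, I_sq]
  norm_num

lemma etaF_ne_zero {z : ℂ} (hz : 0 < z.im) : etaF z ≠ 0 := by
  rw [etaF_eq]
  exact ModularForm.eta_ne_zero hz

lemma Phi20_mul (c : ℂ) (v : Fin 6 → ℂ) : Phi20 (fun i ↦ c * v i) = c ^ 20 * Phi20 v := by
  have hA (j : ℕ) : A j (fun i ↦ c * v i) = c ^ 2 * A j v := by
    unfold A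
    split <;> ring
  have hw (ν : ℕ) : w ν (fun i ↦ c * v i) = c ^ 4 * w ν v := by
    simp_rw [w, hA]
    ring
  have hi : winf (fun i ↦ c * v i) = c ^ 4 * winf v := by
    simp_rw [winf, hA]
    ring
  simp_rw [Phi20, hw, hi, mul_pow, ← mul_sum]
  ring

lemma Phi20_X (z : ℂ) : Phi20 (X z) = etaF z ^ 20 * Phi20 (Avec z) := Phi20_mul _ _

open ModularForm MatrixGroups Filter Topology
open UpperHalfPlane hiding I

lemma differentiableAt_theta (c : ℤ) {z : ℂ} (hz : 0 < z.im) : DifferentiableAt ℂ (theta c) z := by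
  rw [funext (theta_eq_jacobiTheta₂ c)]
  have h : 0 < (13 * z).im := by simpa using hz
  have h' := (hasFDerivAt_jacobiTheta₂ ((c * z + 1) / 2) h).differentiableAt
  have : DifferentiableAt ℂ (fun z : ℂ ↦ jacobiTheta₂ ((c * z + 1) / 2) (13 * z)) z :=
    DifferentiableAt.comp (f := fun z : ℂ ↦ ((c * z + 1) / 2, 13 * z)) z h' (by fun_prop)
  fun_prop

/-- The quotient of the `Φ20`-value of the theta constants by the twelfth power of `η`. -/
def quotForm (τ : ℍ) : ℂ := Phi20 (Avec τ) / etaF τ ^ 12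

lemma quotForm_slash_S : quotForm ∣[(4 : ℤ)] ModularGroup.S = quotForm := by
  ext z
  rw [SL_slash_apply, UpperHalfPlane.modular_S_smul, ModularGroup.denom_S]
  have h1 := Phi20_Avec_neg_inv z.im_pos
  have h2 := etaF_neg_inv_pow z.im_pos
  have hz := z.ne_zero
  have he := etaF_ne_zero z.im_pos
  have h3 : ((-(z : ℂ))⁻¹) = -1 / z := by ring
  simp only [quotForm, h3, h1, h2]
  field_simp

lemma quotForm_slash_T : quotForm ∣[(4 : ℤ)] ModularGroup.T = quotForm := by
  ext z
  rw [SL_slash_apply, modular_T_smul]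
  have h1 := Phi20_Avec_add_one z
  have h2 := etaF_add_one_pow z
  have h3 : denom ModularGroup.T z = 1 := 
    (ModularGroup.denom_apply _ _).trans (by simp [ModularGroup.T])
  have h4 : (((1 : ℝ) +ᵥ z : ℍ) : ℂ) = z + 1 := by simp [add_comm]
  simp only [quotForm, h3, h4, h1, h2]
  simp

lemma differentiableOn_quotForm :
    DifferentiableOn ℂ (fun z ↦ Phi20 (Avec z) / etaF z ^ 12) upperHalfPlaneSet := by
  intro z hz
  refine DifferentiableAt.differentiableWithinAt ?_
  have h1 := differentiableAt_theta 1 hz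
  have h3 := differentiableAt_theta 3 hz
  have h5 := differentiableAt_theta 5 hz
  have h7 := differentiableAt_theta 7 hz
  have h9 := differentiableAt_theta 9 hz
  have h11 := differentiableAt_theta 11 hz
  have he : DifferentiableAt ℂ etaF z := by
    rw [funext etaF_eq]
    exact ModularForm.differentiableAt_eta_of_mem_upperHalfPlaneSet hz
  refine DifferentiableAt.fun_div ?_ (he.fun_pow _) (pow_ne_zero _ (etaF_ne_zero hz))
  simp only [Phi20, w, winf, A, Avec_eq]
  simp
  fun_prop

/-- The level one, weight four modular form underlying `quotForm`. -/
def quotModularForm (h : Tendsto quotForm atImInfty (𝓝 1)) : ModularForm 𝒮ℒ 4 where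
  toFun := quotForm
  slash_action_eq' A hA := by
    obtain ⟨A, rfl⟩ := hA
    exact SlashInvariantForm.slash_action_generators_SL2Z quotForm_slash_S quotForm_slash_T A
  holo' := by
    rw [UpperHalfPlane.mdifferentiable_iff]
    refine .congr differentiableOn_quotForm fun z hz ↦ ?_
    simp [quotForm, ofComplex_apply_of_im_pos hz]
  bdd_at_cusps' {c} hc := by
    rw [Subgroup.IsArithmetic.isCusp_iff_isCusp_SL2Z] at hc
    rw [OnePoint.isBoundedAt_iff_forall_SL2Z hc]
    intro γ _
    rw [SlashInvariantForm.slash_action_generators_SL2Z quotForm_slash_S quotForm_slash_T]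
    exact h.isBigO_one ℝ

lemma quotForm_eq_E₄ (h : Tendsto quotForm atImInfty (𝓝 1)) : quotForm = E₄ := by
  obtain ⟨c, hc⟩ := (finrank_eq_one_iff_of_nonzero' E₄ (EisensteinSeries.E_ne_zero _ ⟨2, rfl⟩)).mp
    (Module.rank_eq_one_iff_finrank_eq_one.mp ModularForm.levelOne_weight_four_rank_one)
    (quotModularForm h)
  have hcoe : (c • E₄ : ℍ → ℂ) = quotForm := congrArg DFunLike.coe hc
  have h0 : (qExpansion 1 (quotModularForm h)).coeff 0 = 1 := by
    rw [UpperHalfPlane.qExpansion_coeff_zero one_pos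
      (ModularFormClass.analyticAt_cuspFunction_zero _ one_pos one_mem_strictPeriods_SL)
      (SlashInvariantFormClass.periodic_comp_ofComplex _ one_mem_strictPeriods_SL)]
    exact h.limUnder_eq
  have h1 : (qExpansion 1 (c • E₄ : ℍ → ℂ)).coeff 0 = c := by
    rw [ModularForm.qExpansion_smul one_pos one_mem_strictPeriods_SL, PowerSeries.coeff_smul,
      EisensteinSeries.E_qExpansion_coeff_zero _ ⟨2, rfl⟩, smul_eq_mul, mul_one]
  have hc1 : c = 1 := by
    rw [← h1, hcoe]
    exact h0
  rw [← hcoe, hc1, one_smul]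

/-- Coprime pairs as the index set of the level one Eisenstein series. -/
def coprimeEquiv : {p : ℤ × ℤ // Int.gcd p.1 p.2 = 1} ≃
    EisensteinSeries.gammaSet 1 1 (0 : Fin 2 → ZMod 1) :=
  (finTwoArrowEquiv ℤ).symm.subtypeEquiv fun p ↦ by
    simp [EisensteinSeries.gammaSet, Subsingleton.elim _ (0 : Fin 2 → ZMod 1)]

lemma E4_eq_E₄ (z : ℍ) : E4 z = E₄ z := by
  have h : E₄ z = (1 / 2 : ℂ) * eisensteinSeries (0 : Fin 2 → ZMod 1) 4 z := rfl
  rw [h, E4, eisensteinSeries, ← coprimeEquiv.tsum_eq]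
  rfl

lemma norm_qp (α : ℚ) (z : ℂ) : ‖qp α z‖ = Real.exp (-(2 * Real.pi * α * z.im)) := by
  rw [qp, Complex.norm_exp]
  congr 1
  simp [mul_re, mul_im]

lemma sq_le_exponent {c : ℤ} (hc : |c| ≤ 11) (n : ℤ) :
    ((n : ℝ)) ^ 2 ≤ (((13 * (n : ℚ) ^ 2 + (c : ℚ) * (n : ℚ)) / 2 : ℚ) : ℝ) := by
  have h : 0 ≤ 11 * n ^ 2 + c * n := by
    rcases eq_or_ne n 0 with rfl | hn
    · simp
    have h1 : |n| ≤ n ^ 2 := by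
      rw [← sq_abs]
      nlinarith [Int.one_le_abs hn]
    have h2 := neg_abs_le (c * n)
    rw [abs_mul] at h2
    nlinarith [abs_nonneg n]
  have h' : (0 : ℝ) ≤ 11 * n ^ 2 + c * n := mod_cast h
  push_cast
  linarith

lemma tendsto_thetaSum {c : ℤ} (hc : |c| ≤ 11) :
    Tendsto (fun τ : ℍ ↦ thetaSum c τ) atImInfty (𝓝 1) := by
  have hnorm (n : ℤ) (τ : ℍ) :
      ‖(-1 : ℂ) ^ n * qp ((13 * (n : ℚ) ^ 2 + (c : ℚ) * (n : ℚ)) / 2) τ‖ ≤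
        Real.exp (-(2 * Real.pi * (n : ℝ) ^ 2 * τ.im)) := by
    rw [norm_mul, norm_zpow, norm_neg, norm_one, one_zpow, one_mul, norm_qp]
    refine Real.exp_le_exp.mpr (neg_le_neg ?_)
    exact mul_le_mul_of_nonneg_right
      (mul_le_mul_of_nonneg_left (sq_le_exponent hc n) (by positivity)) τ.im_pos.le
  have hsum : Summable fun n : ℤ ↦ Real.exp (-Real.pi * (n : ℝ) ^ 2) := by
    have := ((summable_jacobiTheta₂_term_iff 0 I).mpr (by simp)).norm
    simpa [norm_jacobiTheta₂_term] using this
  have key := tendsto_tsum_of_dominated_convergence (𝓕 := atImInfty)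
    (f := fun (τ : ℍ) (n : ℤ) ↦
      (-1 : ℂ) ^ n * qp ((13 * (n : ℚ) ^ 2 + (c : ℚ) * (n : ℚ)) / 2) τ)
    (g := fun n ↦ if n = 0 then 1 else 0) hsum ?_ ?_
  · rwa [tsum_ite_eq] at key
  · intro n
    rcases eq_or_ne n 0 with rfl | hn
    · simp [qp]
    · rw [if_neg hn]
      refine squeeze_zero_norm (hnorm n) (Real.tendsto_exp_neg_atTop_nhds_zero.comp ?_)
      exact tendsto_comap.const_mul_atTop (by positivity)
  · filter_upwards [atImInfty_mem _ |>.mpr ⟨1, fun τ hτ ↦ hτ⟩] with τ hτ n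
    refine (hnorm n τ).trans (Real.exp_le_exp.mpr ?_)
    have hτ' : 1 ≤ τ.im := hτ
    have : 0 ≤ Real.pi * (n : ℝ) ^ 2 := by positivity
    nlinarith

lemma tendsto_eulerProd : Tendsto (fun τ : ℍ ↦
    ∏' n : ℕ, (1 - cexp (2 * Real.pi * I * τ) ^ (n + 1))) atImInfty (𝓝 1) := by
  have h : Tendsto (fun q : ℂ ↦ ∏' n : ℕ, (1 - q ^ (n + 1))) (𝓝 0) (𝓝 1) := by
    have := tendsto_tprod_one_add_of_dominated_convergence (𝓕 := 𝓝 0) (g := 0)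
      (f := fun (q : ℂ) (n : ℕ) ↦ -q ^ (n + 1)) (bound := fun n ↦ (1 / 2 : ℝ) ^ (n + 1))
    simp only [Pi.zero_apply, norm_neg, norm_pow, add_zero, tprod_one] at this
    simp_rw [sub_eq_add_neg]
    refine this
      (by simpa only [pow_succ'] using (summable_geometric_of_abs_lt_one (by norm_num)).mul_left _)
      (fun k ↦ by simpa using ((continuous_pow (M := ℂ) (k + 1)).tendsto 0).neg) ?_
    filter_upwards [Metric.ball_mem_nhds (0 : ℂ) (by norm_num : (0 : ℝ) < 1 / 2)] with q hq k
    exact pow_le_pow_left₀ (norm_nonneg _) (mem_ball_zero_iff.mp hq).le _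
  refine (h.comp (qParam_tendsto_atImInfty zero_lt_one)).congr fun τ ↦ ?_
  simp [Function.Periodic.qParam]

lemma tendsto_qp : Tendsto (fun τ : ℍ ↦ qp (1 / 104) τ) atImInfty (𝓝 0) := by
  refine (qParam_tendsto_atImInfty (h := 104) (by norm_num)).congr fun τ ↦ ?_
  rw [Function.Periodic.qParam, qp]
  push_cast
  ring_nf

lemma qp_natCast_mul (n : ℕ) (α : ℚ) (z : ℂ) : qp (n * α) z = qp α z ^ n := by
  rw [qp, qp, ← Complex.exp_nat_mul]
  push_cast
  ring_nf

/-- The vector of theta constants in terms of `s = q^{1/104}` and the normalised theta sums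
`T = (T₁, T₃, T₅, T₇, T₉, T₁₁)`. -/
def scaledVec (s : ℂ) (T : Fin 6 → ℂ) : Fin 6 → ℂ :=
  ![s ^ 121 * T 5, s ^ 49 * T 3, s ^ 25 * T 2, -(s ^ 9 * T 1), s ^ 81 * T 4, s * T 0]

/-- The quadratic forms `A_j` at `scaledVec s T`, divided by their leading power of `s`. -/
def leadForms (s : ℂ) (T : Fin 6 → ℂ) : Fin 7 → ℂ :=
  ![T 2 * T 0 + s ^ 104 * (T 3 * T 4 - T 5 * T 1), 2 * T 2 * T 1 + s ^ 208 * T 5 ^ 2,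
    2 * T 3 * T 1 - s ^ 104 * T 4 ^ 2, T 3 ^ 2 - 2 * s ^ 104 * T 5 * T 4, T 2 ^ 2 - 2 * T 3 * T 0,
    -T 1 ^ 2 - 2 * s ^ 104 * T 5 * T 0, -T 0 ^ 2 - 2 * s ^ 104 * T 2 * T 4]

lemma continuous_leadForms (j : Fin 7) :
    Continuous fun p : ℂ × (Fin 6 → ℂ) ↦ leadForms p.1 p.2 j := by
  fin_cases j <;> simp [leadForms] <;> fun_prop

/-- The polynomial whose values at `ζ^ν * s ^ 8` give the linear forms `√w_ν`. -/
def leadPoly (b : Fin 7 → ℂ) (x : ℂ) : ℂ :=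
  b 6 + b 5 * x ^ 2 + b 0 * x ^ 3 + b 1 * x ^ 4 + b 4 * x ^ 6 + b 2 * x ^ 7 + b 3 * x ^ 12

/-- The coefficient of `x ^ 4` in `leadPoly b x ^ 10`. -/
def leadCoeffFour (b : Fin 7 → ℂ) : ℂ := 10 * b 6 ^ 9 * b 1 + 45 * b 6 ^ 8 * b 5 ^ 2

/-- The tail of `leadPoly b x ^ 10` after the coefficient of `x ^ 4`, divided by `x ^ 5`. -/
def leadTail (b : Fin 7 → ℂ) (x : ℂ) : ℂ :=
  let Y1 := b 0 + b 1 * x + b 4 * x ^ 3 + b 2 * x ^ 4 + b 3 * x ^ 9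
  let Y := b 5 + x * Y1
  10 * b 6 ^ 9 * (b 4 * x + b 2 * x ^ 2 + b 3 * x ^ 7) +
    45 * b 6 ^ 8 * (2 * b 5 * Y1 + x * Y1 ^ 2) +
    x * ∑ k ∈ range 8, (Nat.choose 10 (k + 3)) * b 6 ^ (7 - k) * Y ^ (k + 3) * x ^ (2 * k)

lemma leadPoly_pow (b : Fin 7 → ℂ) (x : ℂ) : leadPoly b x ^ 10 = b 6 ^ 10 +
    10 * b 6 ^ 9 * b 5 * x ^ 2 + 10 * b 6 ^ 9 * b 0 * x ^ 3 + leadCoeffFour b * x ^ 4 +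
    x ^ 5 * leadTail b x := by
  have h (a Y : ℂ) : (a + x ^ 2 * Y) ^ 10 = a ^ 10 + 10 * a ^ 9 * x ^ 2 * Y +
      45 * a ^ 8 * x ^ 4 * Y ^ 2 + x ^ 6 *
        ∑ k ∈ range 8, (Nat.choose 10 (k + 3)) * a ^ (7 - k) * Y ^ (k + 3) * x ^ (2 * k) := by
    simp only [sum_range_succ, sum_range_zero, Nat.choose]
    push_cast
    ring
  set Y := b 5 + x * (b 0 + b 1 * x + b 4 * x ^ 3 + b 2 * x ^ 4 + b 3 * x ^ 9) with hY
  have hP : leadPoly b x = b 6 + x ^ 2 * Y := by rw [leadPoly, hY]; ring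
  rw [hP, h]
  simp only [leadTail, leadCoeffFour, ← hY]
  generalize ∑ k ∈ range 8, (Nat.choose 10 (k + 3) : ℂ) * b 6 ^ (7 - k) * Y ^ (k + 3) *
    x ^ (2 * k) = W
  rw [hY]
  ring

lemma sum_zeta_pow {m : ℕ} (hm : Nat.Coprime m 13) :
    ∑ ν ∈ range 13, (ζ ^ ν) ^ m = 0 := by
  have h : IsPrimitiveRoot ζ 13 := Complex.isPrimitiveRoot_exp 13 (by norm_num)
  have := (h.pow_of_coprime m hm).geom_sum_eq_zero (by norm_num)
  simpa only [← pow_mul, mul_comm] using this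

lemma zeta_pow_thirteen : ζ ^ 13 = 1 :=
  (Complex.isPrimitiveRoot_exp 13 (by norm_num)).pow_eq_one

lemma w_scaledVec (s : ℂ) (T : Fin 6 → ℂ) (ν : ℕ) : w ν (scaledVec s T) ^ 5 =
    s ^ 20 * ((ζ ^ ν) ^ 9 * leadPoly (leadForms s T) (ζ ^ ν * s ^ 8) ^ 10) := by
  have hz : (ζ ^ ν) ^ 13 = 1 := by rw [← pow_mul, mul_comm, pow_mul, zeta_pow_thirteen, one_pow]
  have h1 : A 0 (scaledVec s T) + ζ ^ ν * A 1 (scaledVec s T) + ζ ^ (4 * ν) * A 2 (scaledVec s T)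
      + ζ ^ (9 * ν) * A 3 (scaledVec s T) + ζ ^ (3 * ν) * A 4 (scaledVec s T)
      + ζ ^ (12 * ν) * A 5 (scaledVec s T) + ζ ^ (10 * ν) * A 6 (scaledVec s T) =
      s ^ 2 * ((ζ ^ ν) ^ 10 * leadPoly (leadForms s T) (ζ ^ ν * s ^ 8)) := by
    have h0 : A 0 (scaledVec s T) = s ^ 26 * leadForms s T 0 := by
      simp [A, scaledVec, leadForms]; ring
    have h1 : A 1 (scaledVec s T) = s ^ 34 * leadForms s T 1 := by
      simp [A, scaledVec, leadForms]; ring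
    have h2 : A 2 (scaledVec s T) = s ^ 58 * leadForms s T 2 := by
      simp [A, scaledVec, leadForms]; ring
    have h3 : A 3 (scaledVec s T) = s ^ 98 * leadForms s T 3 := by
      simp [A, scaledVec, leadForms]; ring
    have h4 : A 4 (scaledVec s T) = s ^ 50 * leadForms s T 4 := by
      simp [A, scaledVec, leadForms]; ring
    have h5 : A 5 (scaledVec s T) = s ^ 18 * leadForms s T 5 := by
      simp [A, scaledVec, leadForms]; ring
    have h6 : A 6 (scaledVec s T) = s ^ 2 * leadForms s T 6 := by
      simp [A, scaledVec, leadForms]; ring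
    rw [h0, h1, h2, h3, h4, h5, h6, leadPoly]
    generalize leadForms s T = b
    simp only [mul_comm _ ν, pow_mul]
    generalize ζ ^ ν = x at *
    linear_combination (-1) * (s ^ 26 * b 0 + x * s ^ 34 * b 1 + x ^ 3 * s ^ 50 * b 4 +
      x ^ 4 * s ^ 58 * b 2 + x ^ 9 * s ^ 98 * b 3) * hz
  rw [w, h1]
  generalize leadPoly _ _ = P
  generalize ζ ^ ν = x at *
  have h100 : x ^ 100 = x ^ 9 := by
    rw [show 100 = 13 * 7 + 9 by norm_num, pow_add, pow_mul, hz, one_pow, one_mul]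
  linear_combination s ^ 20 * P ^ 10 * h100

lemma winf_scaledVec (s : ℂ) (T : Fin 6 → ℂ) :
    winf (scaledVec s T) ^ 5 = s ^ 52 * (13 ^ 5 * s ^ 208 * leadForms s T 0 ^ 10) := by
  simp [winf, A, scaledVec, leadForms]
  ring

lemma sum_leadPoly_pow (b : Fin 7 → ℂ) (t : ℂ) :
    ∑ ν ∈ range 13, (ζ ^ ν) ^ 9 * leadPoly b (ζ ^ ν * t) ^ 10 =
      t ^ 4 * (13 * leadCoeffFour b + t * ∑ ν ∈ range 13, (ζ ^ ν) ^ 14 * leadTail b (ζ ^ ν * t)) := by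
  have h13 : ∑ ν ∈ range 13, (ζ ^ ν) ^ 13 = 13 := by
    have h (ν : ℕ) : (ζ ^ ν) ^ 13 = 1 := by
      rw [← pow_mul, mul_comm, pow_mul, zeta_pow_thirteen, one_pow]
    simp [h]
  have h9 := sum_zeta_pow (m := 9) (by norm_num)
  have h11 := sum_zeta_pow (m := 11) (by norm_num)
  have h12 := sum_zeta_pow (m := 12) (by norm_num)
  calc _ = ∑ ν ∈ range 13, (b 6 ^ 10 * (ζ ^ ν) ^ 9 + 10 * b 6 ^ 9 * b 5 * t ^ 2 * (ζ ^ ν) ^ 11 +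
        10 * b 6 ^ 9 * b 0 * t ^ 3 * (ζ ^ ν) ^ 12 + t ^ 4 * leadCoeffFour b * (ζ ^ ν) ^ 13 +
        t ^ 5 * ((ζ ^ ν) ^ 14 * leadTail b (ζ ^ ν * t))) := by
        refine sum_congr rfl fun ν _ ↦ ?_
        rw [leadPoly_pow]
        ring
    _ = _ := by
        simp only [sum_add_distrib, ← mul_sum, h9, h11, h12, h13]
        ring

/-- The value of `Phi20` at `scaledVec s T`, divided by `s ^ 52`. -/
def leadQuot (s : ℂ) (T : Fin 6 → ℂ) : ℂ :=
  1 / (13 * 25) * (13 * leadCoeffFour (leadForms s T) +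
    s ^ 8 * (∑ ν ∈ range 13, (ζ ^ ν) ^ 14 * leadTail (leadForms s T) (ζ ^ ν * s ^ 8)) +
    13 ^ 5 * s ^ 208 * leadForms s T 0 ^ 10)

lemma Phi20_scaledVec (s : ℂ) (T : Fin 6 → ℂ) :
    Phi20 (scaledVec s T) = s ^ 52 * leadQuot s T := by
  rw [Phi20, winf_scaledVec, sum_congr rfl fun ν _ ↦ w_scaledVec s T ν, ← mul_sum,
    sum_leadPoly_pow, leadQuot]
  ring

lemma continuous_leadQuot : Continuous fun p : ℂ × (Fin 6 → ℂ) ↦ leadQuot p.1 p.2 := by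
  have h := continuous_leadForms
  simp only [leadQuot, leadCoeffFour, leadTail]
  fun_prop

lemma leadQuot_zero_one : leadQuot 0 (fun _ ↦ 1) = 1 := by
  simp [leadQuot, leadCoeffFour, leadForms]
  norm_num

/-- The normalised theta sums with limit `1` at `i∞`. -/
def thetaSums (z : ℂ) : Fin 6 → ℂ :=
  ![thetaSum 1 z, thetaSum 3 z, thetaSum 5 z, thetaSum 7 z, thetaSum 9 z, thetaSum 11 z]

lemma Avec_eq_scaledVec (z : ℂ) : Avec z = scaledVec (qp (1 / 104) z) (thetaSums z) := by
  have h (n : ℕ) : qp (n / 104) z = qp (1 / 104) z ^ n := by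
    rw [← qp_natCast_mul]
    ring_nf
  have h1 := h 9
  have h2 := h 25
  have h3 := h 49
  have h4 := h 81
  have h5 := h 121
  push_cast at h1 h2 h3 h4 h5
  ext i
  fin_cases i <;> simp only [Avec, thc, h1, h2, h3, h4, h5] <;> rfl

lemma quotForm_eq_leadQuot (τ : ℍ) : quotForm τ = leadQuot (qp (1 / 104) τ) (thetaSums τ) /
    (∏' n : ℕ, (1 - cexp (2 * Real.pi * I * τ) ^ (n + 1))) ^ 12 := by
  have h : qp (1 / 24) τ ^ 12 = qp (1 / 104) τ ^ 52 := by
    rw [← qp_natCast_mul, ← qp_natCast_mul]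
    norm_num
  have hs : qp (1 / 104) τ ≠ 0 := exp_ne_zero _
  rw [quotForm, Avec_eq_scaledVec, Phi20_scaledVec, etaF, mul_pow, h,
    mul_div_mul_left _ _ (pow_ne_zero _ hs)]

lemma tendsto_quotForm : Tendsto quotForm atImInfty (𝓝 1) := by
  have hT : Tendsto (fun τ : ℍ ↦ thetaSums τ) atImInfty (𝓝 fun _ ↦ 1) := by
    rw [tendsto_pi_nhds]
    intro i
    fin_cases i <;> exact tendsto_thetaSum (by norm_num)
  have h1 := (continuous_leadQuot.tendsto (0, fun _ ↦ 1)).comp (tendsto_qp.prodMk_nhds hT)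
  have h2 := h1.div (tendsto_eulerProd.pow 12) (by simp)
  simp only [leadQuot_zero_one, one_pow, div_one] at h2
  exact h2.congr fun τ ↦ (quotForm_eq_leadQuot τ).symm

lemma Phi20_Avec {z : ℂ} (hz : 0 < z.im) : Phi20 (Avec z) = etaF z ^ 12 * E4 z := by
  have h := congrFun (quotForm_eq_E₄ tendsto_quotForm) ⟨z, hz⟩
  rw [← E4_eq_E₄, quotForm, div_eq_iff (pow_ne_zero _ (etaF_ne_zero hz))] at h
  rw [mul_comm]
  exact h

end Order13

/-- `Φ20(x1(z),…,x6(z)) = η(z)^8·Δ(z)·E4(z)` on ℍ. -/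
theorem stmt_16 (z : ℂ) (hz : 0 < z.im) : Phi20 (X z) = etaF z ^ 8 * Delta z * E4 z := by
  rw [Order13.Phi20_X, Order13.Phi20_Avec hz, Delta]
  ring

end
end
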